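/- Recurrence (5.10) in the proof of Theorem 3.1 (obtained by Kuo condensation): Let x,y,n be nonnegative integers with y > 0, let U, D ⊆ [x+y+n] with |U∪D| = n, let B ⊆ [x+y+n]\(U∪D) with |B| < x, and let α and β (α < β) be the first and last positions of [x+y+n]\(U∪D∪B). Then M(F_{x,y}(U;D;B)) · M(F_{x−1,y−1}(U∪{α,β};D;B)) = M(F_{x−1,y}(U∪{β};D;B)) · M(F_{x,y−1}(U∪{α};D;B)) + M(F_{x−1,y}(U∪{α};D;B)) · M(F_{x,y−1}(U∪{β};D;B)). -/

import Mathlib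

open Finset

/-- A unit triangle of the triangular lattice, in sheared coordinates:
`(true, a, j)` is the up-pointing triangle with horizontal base
`[a + j/2, a + 1 + j/2]` on the lattice line at height `j`;
`(false, a, j)` is the down-pointing triangle with apex `(a + 1 + j/2, j)`
and top edge on the lattice line at height `j + 1`. -/
abbrev Tri : Type := Bool × ℤ × ℤ

def upT (a j : ℤ) : Tri := (true, a, j)
def dnT (a j : ℤ) : Tri := (false, a, j)

/-- A lozenge (union of two unit triangles sharing an edge), recorded by the
coordinates of its up-pointing triangle (first component) and of its
down-pointing triangle (second component). -/
abbrev Loz : Type := (ℤ × ℤ) × (ℤ × ℤ)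

/-- The two triangles of a lozenge share an edge: the down-pointing triangle is
the right, left or lower neighbour of the up-pointing one. -/
def lozAdj (l : Loz) : Prop :=
  l.2 = l.1 ∨ l.2 = (l.1.1 - 1, l.1.2) ∨ l.2 = (l.1.1, l.1.2 - 1)

/-- `T` is a lozenge tiling of the region `R`: it consists of lozenges lying in
`R` and covers every unit triangle of `R` exactly once. -/
def IsTiling (R : Finset Tri) (T : Finset Loz) : Prop :=
  (∀ l ∈ T, lozAdj l ∧ upT l.1.1 l.1.2 ∈ R ∧ dnT l.2.1 l.2.2 ∈ R) ∧
  (∀ t ∈ R, ∃! l, l ∈ T ∧ (t = upT l.1.1 l.1.2 ∨ t = dnT l.2.1 l.2.2))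

/-- All lozenge tilings of `R` avoiding the forbidden lozenges in `F`
(the barriers), collected in a finset. -/
noncomputable def tilings (R : Finset Tri) (F : Finset Loz) : Finset (Finset Loz) := by
  classical
  exact ((R.image Prod.snd ×ˢ R.image Prod.snd).powerset).filter
    (fun T => IsTiling R T ∧ ∀ l ∈ T, l ∉ F)

/-- `Mtil R F` : the number of lozenge tilings of `R` avoiding the barriers `F`. -/
noncomputable def Mtil (R : Finset Tri) (F : Finset Loz) : ℕ := (tilings R F).card

/-- Weighted tiling number: each lozenge in `Wt` carries weight `1/2`, all other
lozenges weight `1`; a tiling is weighted by the product of its lozenge weights. -/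
noncomputable def Mw (R : Finset Tri) (F : Finset Loz) (Wt : Finset Loz) : ℚ :=
  ∑ T ∈ tilings R F, (1 / 2 : ℚ) ^ (T ∩ Wt).card

/-- Reflection of a unit triangle over the horizontal lattice line `l` (height `0`). -/
def reflTri (t : Tri) : Tri :=
  if t.1 then (false, t.2.1 + t.2.2, -t.2.2 - 1) else (true, t.2.1 + t.2.2 + 1, -t.2.2 - 1)

/-- Reflection of a lozenge over the horizontal lattice line `l` (height `0`). -/
def reflLoz (l : Loz) : Loz :=
  ((l.2.1 + l.2.2 + 1, -l.2.2 - 1), (l.1.1 + l.1.2, -l.1.2 - 1))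

/-- The up-pointing unit triangles removed at the positions of `U`
(1-indexed, from left to right) just above the line `l`. -/
def upDents (U : Finset ℕ) : Finset Tri := U.image (fun (i : ℕ) => upT ((i : ℤ) - 1) 0)

/-- The down-pointing unit triangles removed at the positions of `D`
(1-indexed, from left to right) just below the line `l`. -/
def dnDents (D : Finset ℕ) : Finset Tri := D.image (fun (i : ℕ) => dnT ((i : ℤ) - 1) (-1))

/-- The vertical lozenges straddling the line `l` at the barrier positions `B`:
these are forbidden in any tiling. -/
def barrierLoz (B : Finset ℕ) : Finset Loz :=
  B.image (fun (i : ℕ) => (((i : ℤ) - 1, 0), ((i : ℤ) - 1, -1)))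

/-- The upper half of a hexagon: the semihexagon (trapezoid) with base `W` on the
line `l` and `h` rows of unit triangles above it. -/
def upperHex (W h : ℕ) : Finset Tri :=
  (Finset.range h).biUnion fun j =>
    ((Finset.range (W - j)).image fun (a : ℕ) => upT (a : ℤ) (j : ℤ)) ∪
    ((Finset.range (W - j - 1)).image fun (a : ℕ) => dnT (a : ℤ) (j : ℤ))

/-- The doubly-dented hexagon `H_{x,y}(U; D)` (with `n = |U ∪ D|` recorded
explicitly): the hexagon of side lengths `x+n-u, y+u, y+d, x+n-d, y+d, y+u`
(clockwise from the north side) with the up-pointing unit triangles at the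
positions of `U` and the down-pointing unit triangles at the positions of `D`
removed along the horizontal axis `l` through its west and east vertices. -/
def Hreg (x y n : ℕ) (U D : Finset ℕ) : Finset Tri :=
  (upperHex (x + y + n) (y + U.card) \ upDents U) ∪
  ((upperHex (x + y + n) (y + D.card)).image reflTri \ dnDents D)

/-- The quartered hexagon `L_{m,n}(A)`: the trapezoid whose northern,
northeastern, southern sides have lengths `n`, `m`, `n + ⌊(m+1)/2⌋` and whose
western side is a vertical zigzag of `m` steps, with the up-pointing unit
triangles at the positions of `A` removed from the base. -/
def Lreg (m n : ℕ) (A : Finset ℕ) : Finset Tri :=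
  ((Finset.range m).biUnion fun j =>
    ((Finset.range (n + (m + 1) / 2 + j / 2 - j)).image
        fun (a : ℕ) => upT ((a : ℤ) - ((j / 2 : ℕ) : ℤ)) (j : ℤ)) ∪
    ((Finset.range (n + (m + 1) / 2 + (j + 1) / 2 - (j + 1))).image
        fun (a : ℕ) => dnT ((a : ℤ) - (((j + 1) / 2 : ℕ) : ℤ)) (j : ℤ)))
  \ upDents A

/-- The vertical lozenges sitting along (the bumps of) the western zigzag side
of the quartered hexagon `L_{m,n}`; these get weight `1/2` in `L̄_{m,n}`. -/
def westLoz (m : ℕ) : Finset Loz :=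
  ((Finset.range m).filter fun j => j % 2 = 1).image fun j =>
    ((-(((j - 1) / 2 : ℕ) : ℤ), (j : ℤ)), (-(((j - 1) / 2 : ℕ) : ℤ), (j : ℤ) - 1))

/-- The doubly-dented halved hexagon `F_{x,y}(U; D)`: north, northeast,
southeast, south sides of lengths `x+n-u, 2y+2u, 2y+2d, x+n-d`, western side a
vertical zigzag with `4y+2u+2d` steps, with up-dents `U` and down-dents `D`
along the horizontal line `l` through the east vertex. -/
def Freg (x y n : ℕ) (U D : Finset ℕ) : Finset Tri :=
  Lreg (2 * y + 2 * U.card) (x + n - U.card) U ∪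
  (Lreg (2 * y + 2 * D.card) (x + n - D.card) D).image reflTri

/-- The doubly-dented halved hexagon `F̄_{x,y}(U; D)`: side lengths
`x+n-u, 2y-1+2u, 2y-1+2d, x+n-d` and a western zigzag with `4y+2u+2d-2` steps,
with up-dents `U` and down-dents `D` along the line `l` through the east vertex. -/
def Fbar (x y n : ℕ) (U D : Finset ℕ) : Finset Tri :=
  Lreg (2 * y + 2 * U.card - 1) (x + n - U.card) U ∪
  (Lreg (2 * y + 2 * D.card - 1) (x + n - D.card) D).image reflTri

/-- The weight-`1/2` vertical lozenges on the western side of `W_{x,y}(U;D;B)`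
(where `u = |U|`, `d = |D|`). -/
def wtW (y u d : ℕ) : Finset Loz :=
  westLoz (2 * y + 2 * u) ∪ (westLoz (2 * y + 2 * d)).image reflLoz

/-- The weight-`1/2` vertical lozenges on the western side of `W̄_{x,y}(U;D;B)`. -/
def wtWbar (y u d : ℕ) : Finset Loz :=
  westLoz (2 * y + 2 * u - 1) ∪ (westLoz (2 * y + 2 * d - 1)).image reflLoz

/-- `m - S = {m - s : s ∈ S}`. -/
def mirrorSet (m : ℕ) (S : Finset ℕ) : Finset ℕ := S.image fun i => m - i

/-- The reflectively symmetric doubly-dented hexagon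
`RS_{x,y}(U;D) = H_{x,y}(U ∪ ((x+y+2n+1)-U); D ∪ ((x+y+2n+1)-D))`. -/
def RSreg (x y n : ℕ) (U D : Finset ℕ) : Finset Tri :=
  Hreg x y (2 * n) (U ∪ mirrorSet (x + y + 2 * n + 1) U)
    (D ∪ mirrorSet (x + y + 2 * n + 1) D)

/-- Reflection of a lozenge over the vertical symmetry axis of a region whose
base on the line `l` spans the horizontal interval `[0, W]`. -/
def vreflLoz (W : ℤ) (l : Loz) : Loz :=
  ((W - 1 - l.1.1 - l.1.2, l.1.2), (W - 2 - l.2.1 - l.2.2, l.2.2))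

/-- The number of lozenge tilings of `R` (avoiding the barriers `F`) invariant
under the reflection over the vertical axis of a base of width `W`. -/
noncomputable def Msym (R : Finset Tri) (F : Finset Loz) (W : ℤ) : ℕ := by
  classical
  exact ((tilings R F).filter fun T => T.image (vreflLoz W) = T).card

/-- `M_r(RS_{x,y}(U;D;B))` : the number of reflectively symmetric lozenge
tilings of the symmetric doubly-dented hexagon with barriers at
`B ∪ ((x+y+2n+1)-B)`. -/
noncomputable def Mr (x y n : ℕ) (U D B : Finset ℕ) : ℕ :=
  Msym (RSreg x y n U D)
    (barrierLoz (B ∪ mirrorSet (x + y + 2 * n + 1) B))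
    ((x : ℤ) + (y : ℤ) + 2 * (n : ℤ))

/-- The skipping hyperfactorial: `H2 (2k) = 0! 2! ⋯ (2k-2)!` and
`H2 (2k+1) = 1! 3! ⋯ (2k-1)!`. -/
def H2 (n : ℕ) : ℕ :=
  ∏ j ∈ (Finset.range n).filter (fun j => j % 2 = n % 2), Nat.factorial j

/-- `∏_{1 ≤ i < j ≤ k} (s_j² - s_i²)` for the increasing enumeration
`s_1 < ⋯ < s_k` of `S`. -/
def prodDiffSq (S : Finset ℕ) : ℚ :=
  ∏ p ∈ S, ∏ q ∈ S.filter (fun q => p < q), ((q : ℚ) ^ 2 - (p : ℚ) ^ 2)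

/-- `∏_{1 ≤ i < j ≤ k} (s_j - s_i)`. -/
def prodDiff (S : Finset ℕ) : ℚ :=
  ∏ p ∈ S, ∏ q ∈ S.filter (fun q => p < q), ((q : ℚ) - (p : ℚ))

/-- `∏_{1 ≤ i < j ≤ k} (s_j - s_i)(s_j + s_i - 1)`. -/
def prodDS1 (S : Finset ℕ) : ℚ :=
  ∏ p ∈ S, ∏ q ∈ S.filter (fun q => p < q), (((q : ℚ) - (p : ℚ)) * ((q : ℚ) + (p : ℚ) - 1))

/-- `∏_{1 ≤ i < j ≤ k} (s_j - s_i)(s_j + s_i - 2)`. -/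
def prodDS2 (S : Finset ℕ) : ℚ :=
  ∏ p ∈ S, ∏ q ∈ S.filter (fun q => p < q), (((q : ℚ) - (p : ℚ)) * ((q : ℚ) + (p : ℚ) - 2))

/-- `∏_{1 ≤ i < j ≤ k} (s_i + s_j)`. -/
def prodSum0 (S : Finset ℕ) : ℚ :=
  ∏ p ∈ S, ∏ q ∈ S.filter (fun q => p < q), ((q : ℚ) + (p : ℚ))

/-- `∏_{1 ≤ i < j ≤ k} (s_i + s_j - 1)`. -/
def prodSum1 (S : Finset ℕ) : ℚ :=
  ∏ p ∈ S, ∏ q ∈ S.filter (fun q => p < q), ((q : ℚ) + (p : ℚ) - 1)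

/-- `∏_{1 ≤ i < j ≤ k} (s_i + s_j - 2)`. -/
def prodSum2 (S : Finset ℕ) : ℚ :=
  ∏ p ∈ S, ∏ q ∈ S.filter (fun q => p < q), ((q : ℚ) + (p : ℚ) - 2)

/-- `∏_{1 ≤ i ≤ j ≤ k} (s_i + s_j - 1)` (the diagonal `i = j` included). -/
def prodSumLe1 (S : Finset ℕ) : ℚ :=
  ∏ p ∈ S, ∏ q ∈ S.filter (fun q => p ≤ q), ((q : ℚ) + (p : ℚ) - 1)

theorem isTiling_iff (R : Finset Tri) (T : Finset Loz) :
    IsTiling R T ↔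
      (∀ l ∈ T, lozAdj l ∧ upT l.1.1 l.1.2 ∈ R ∧ dnT l.2.1 l.2.2 ∈ R) ∧
      (∀ a j, upT a j ∈ R → ∃ l ∈ T, l.1 = (a, j)) ∧
      (∀ a j, dnT a j ∈ R → ∃ l ∈ T, l.2 = (a, j)) ∧
      (∀ l ∈ T, ∀ l' ∈ T, l.1 = l'.1 → l = l') ∧
      (∀ l ∈ T, ∀ l' ∈ T, l.2 = l'.2 → l = l') := by
  unfold IsTiling
  refine and_congr_right fun h => ⟨fun h2 => ⟨?_, ?_, ?_, ?_⟩, ?_⟩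
  · intro a j ha
    obtain ⟨l, ⟨hl, h3⟩, -⟩ := h2 _ ha
    refine ⟨l, hl, ?_⟩
    simp [upT, dnT] at h3
    exact h3.symm
  · intro a j ha
    obtain ⟨l, ⟨hl, h3⟩, -⟩ := h2 _ ha
    refine ⟨l, hl, ?_⟩
    simp [upT, dnT] at h3
    exact h3.symm
  · intro l hl l' hl' e
    obtain ⟨m, -, hm⟩ := h2 _ (h l hl).2.1
    rw [hm l ⟨hl, Or.inl rfl⟩, hm l' ⟨hl', Or.inl (by rw [e])⟩]
  · intro l hl l' hl' e
    obtain ⟨m, -, hm⟩ := h2 _ (h l hl).2.2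
    rw [hm l ⟨hl, Or.inr rfl⟩, hm l' ⟨hl', Or.inr (by rw [e])⟩]
  · rintro ⟨hu, hd, iu, id⟩ ⟨b, a, j⟩ ht
    cases b
    · obtain ⟨l, hl, e⟩ := hd a j ht
      refine ⟨l, ⟨hl, Or.inr (by simp [dnT, e])⟩, ?_⟩
      rintro l' ⟨hl', e'⟩
      refine id _ hl' _ hl ?_
      rw [e]
      simp [upT, dnT] at e'
      exact e'.symm
    · obtain ⟨l, hl, e⟩ := hu a j ht
      refine ⟨l, ⟨hl, Or.inl (by simp [upT, e])⟩, ?_⟩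
      rintro l' ⟨hl', e'⟩
      refine iu _ hl' _ hl ?_
      rw [e]
      simp [upT, dnT] at e'
      exact e'.symm

theorem mem_tilings (R : Finset Tri) (F T : Finset Loz) :
    T ∈ tilings R F ↔ IsTiling R T ∧ ∀ l ∈ T, l ∉ F := by
  unfold tilings
  simp only [mem_filter, mem_powerset, and_iff_right_iff_imp]
  rintro ⟨⟨h, -⟩, -⟩ l hl
  obtain ⟨-, h1, h2⟩ := h l hl
  exact mem_product.2 ⟨mem_image.2 ⟨_, h1, rfl⟩, mem_image.2 ⟨_, h2, rfl⟩⟩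

theorem lozAdj_height {l : Loz} (h : lozAdj l) (j : ℤ) :
    (l.1.2 < j ∧ l.2.2 < j) ∨ (j ≤ l.1.2 ∧ j ≤ l.2.2) ∨ l = ((l.1.1, j), (l.1.1, j - 1)) := by
  obtain ⟨⟨a, b⟩, c, d⟩ := l
  change (b < j ∧ d < j) ∨ (j ≤ b ∧ j ≤ d) ∨ ((a, b), (c, d)) = ((a, j), (a, j - 1))
  simp only [Prod.mk.injEq, true_and]
  rcases h with h | h | h <;> obtain ⟨h₁, h₂⟩ := Prod.mk.inj h <;>
    (try dsimp only at h₁ h₂) <;> omega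

/-- The vertical lozenge whose horizontal diagonal is the cell `a` of the line at height `j`. -/
def vertLoz (a j : ℤ) : Loz := ((a, j), (a, j - 1))

set_option maxHeartbeats 1000000 in
/-- Cutting a region along the horizontal line at height `j`: a tiling restricts to tilings of the
parts below and above the line, once the vertical lozenges crossing the line are removed. -/
theorem Mtil_cut {ι : Type*} [DecidableEq ι] (R₁ R₂ : Finset Tri) (F : Finset Loz) (j : ℤ)
    (h₁ : ∀ t ∈ R₁, t.2.2 < j) (h₂ : ∀ t ∈ R₂, j ≤ t.2.2)
    (φ : ι → ℤ) (hφ : Function.Injective φ) (C : Finset ι)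
    (hC : ∀ i ∈ C, upT (φ i) j ∈ R₂ ∧ dnT (φ i) (j - 1) ∈ R₁ ∧ vertLoz (φ i) j ∉ F)
    (hC' : ∀ a, upT a j ∈ R₂ → dnT a (j - 1) ∈ R₁ → vertLoz a j ∉ F → ∃ i ∈ C, φ i = a) :
    Mtil (R₁ ∪ R₂) F = ∑ S ∈ C.powerset,
      Mtil (R₁ \ S.image fun i => dnT (φ i) (j - 1)) F *
        Mtil (R₂ \ S.image fun i => upT (φ i) j) F := by
  classical
  have hup : ∀ a k, upT a k ∈ R₁ → k < j := fun a k h => h₁ _ h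
  have hup' : ∀ a k, upT a k ∈ R₂ → j ≤ k := fun a k h => h₂ _ h
  have hdn : ∀ a k, dnT a k ∈ R₁ → k < j := fun a k h => h₁ _ h
  have hdn' : ∀ a k, dnT a k ∈ R₂ → j ≤ k := fun a k h => h₂ _ h
  have eu : ∀ a b c d, upT a b = upT c d ↔ a = c ∧ b = d := by simp [upT]
  have ed : ∀ a b c d, dnT a b = dnT c d ↔ a = c ∧ b = d := by simp [dnT]
  have eud : ∀ a b c d, upT a b ≠ dnT c d := by simp [upT, dnT]
  unfold Mtil
  simp only [← card_product]
  rw [← card_sigma]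
  have nu : ∀ (S : Finset ι) a k, upT a k ∉ S.image fun i => dnT (φ i) (j - 1) := by
    simp [upT, dnT]
  have nd : ∀ (S : Finset ι) a k, dnT a k ∉ S.image fun i => upT (φ i) j := by
    simp [upT, dnT]
  have mu : ∀ (S : Finset ι) a k, (upT a k ∈ S.image fun i => upT (φ i) j) ↔
      k = j ∧ ∃ i ∈ S, φ i = a := by
    intro S a k; simp [upT]; aesop
  have md : ∀ (S : Finset ι) a k, (dnT a k ∈ S.image fun i => dnT (φ i) (j - 1)) ↔
      k = j - 1 ∧ ∃ i ∈ S, φ i = a := by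
    intro S a k; simp [dnT]; aesop
  refine card_nbij'
    (fun T => ⟨C.filter fun i => vertLoz (φ i) j ∈ T,
      (T.filter fun l => l.1.2 < j, T.filter fun l => j ≤ l.2.2)⟩)
    (fun s => s.2.1 ∪ s.2.2 ∪ s.1.image fun i => vertLoz (φ i) j) ?_ ?_ ?_ ?_
  · intro T hT
    simp only [coe_sigma, Set.mem_sigma_iff, mem_coe, mem_tilings, isTiling_iff, mem_product,
      mem_powerset] at hT ⊢
    obtain ⟨⟨hm, hu, hd, iu, id⟩, hF⟩ := hT
    simp only [mem_union] at hm hu hd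
    have tri := fun l hl => lozAdj_height (hm l hl).1 j
    refine ⟨filter_subset _ _, ⟨⟨?_, ?_, ?_, ?_, ?_⟩, ?_⟩, ⟨⟨?_, ?_, ?_, ?_, ?_⟩, ?_⟩⟩ <;>
      simp only [mem_filter, mem_sdiff, nu, nd, mu, md]
    · grind [vertLoz]
    · grind [vertLoz]
    · grind [vertLoz]
    · grind [vertLoz]
    · grind [vertLoz]
    · grind [vertLoz]
    · grind [vertLoz]
    · grind [vertLoz]
    · grind [vertLoz]
    · grind [vertLoz]
    · grind [vertLoz]
    · grind [vertLoz]
  · rintro ⟨S, T₁, T₂⟩ hT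
    simp only [coe_sigma, Set.mem_sigma_iff, mem_coe, mem_tilings, isTiling_iff, mem_product,
      mem_powerset] at hT ⊢
    obtain ⟨hS, ⟨⟨hm, hu, hd, iu, id⟩, hF⟩, ⟨⟨hm', hu', hd', iu', id'⟩, hF'⟩⟩ := hT
    simp only [mem_sdiff, nu, nd, mu, md] at hm hu hd hm' hu' hd'
    refine ⟨⟨?_, ?_, ?_, ?_, ?_⟩, ?_⟩ <;> simp only [mem_union, mem_image]
    · grind [vertLoz, lozAdj]
    · grind [vertLoz]
    · grind [vertLoz]
    · grind [vertLoz]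
    · grind [vertLoz]
    · grind [vertLoz]
  · intro T hT
    simp only [mem_coe, mem_tilings, isTiling_iff] at hT
    obtain ⟨⟨hm, hu, hd, iu, id⟩, hF⟩ := hT
    simp only [mem_union] at hm hu hd
    have tri := fun l hl => lozAdj_height (hm l hl).1 j
    ext l
    simp only [mem_union, mem_image, mem_filter]
    grind [vertLoz]
  · rintro ⟨S, T₁, T₂⟩ hT
    simp only [coe_sigma, Set.mem_sigma_iff, mem_coe, mem_tilings, isTiling_iff, mem_product,
      mem_powerset] at hT ⊢
    obtain ⟨hS, ⟨⟨hm, hu, hd, iu, id⟩, hF⟩, ⟨⟨hm', hu', hd', iu', id'⟩, hF'⟩⟩ := hT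
    simp only [mem_sdiff, nu, nd, mu, md] at hm hu hd hm' hu' hd'
    have e₁ : (C.filter fun i => vertLoz (φ i) j ∈ T₁ ∪ T₂ ∪ S.image fun i => vertLoz (φ i) j) = S := by
      ext i
      simp only [mem_union, mem_image, mem_filter]
      grind [vertLoz]
    have e₂ : ((T₁ ∪ T₂ ∪ S.image fun i => vertLoz (φ i) j).filter fun l => l.1.2 < j) = T₁ := by
      ext l
      simp only [mem_union, mem_image, mem_filter]
      grind [vertLoz]
    have e₃ : ((T₁ ∪ T₂ ∪ S.image fun i => vertLoz (φ i) j).filter fun l => j ≤ l.2.2) = T₂ := by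
      ext l
      simp only [mem_union, mem_image, mem_filter]
      grind [vertLoz]
    rw [e₁, e₂, e₃]

theorem Mtil_eq_of_not_mem (R : Finset Tri) (F : Finset Loz)
    (h : ∀ l ∈ F, upT l.1.1 l.1.2 ∈ R → dnT l.2.1 l.2.2 ∉ R) : Mtil R F = Mtil R ∅ := by
  unfold Mtil
  congr 1
  ext T
  simp only [mem_tilings, notMem_empty, not_false_eq_true, implies_true, and_true,
    and_iff_left_iff_imp]
  exact fun hT l hl hF => h l hF (hT.1 l hl).2.1 (hT.1 l hl).2.2

theorem Mtil_empty (F : Finset Loz) : Mtil ∅ F = 1 := by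
  unfold Mtil
  have : tilings ∅ F = {∅} := by
    ext T
    simp only [mem_tilings, isTiling_iff, mem_singleton]
    constructor
    · rintro ⟨⟨h, -⟩, -⟩
      exact eq_empty_of_forall_notMem fun l hl => by simpa using (h l hl).2.1
    · rintro rfl
      simp
  rw [this, card_singleton]

theorem reflTri_reflTri (t : Tri) : reflTri (reflTri t) = t := by
  obtain ⟨b, a, j⟩ := t
  cases b <;> (simp [reflTri]; try ring)

theorem reflLoz_reflLoz (l : Loz) : reflLoz (reflLoz l) = l := by
  obtain ⟨⟨a, b⟩, c, d⟩ := l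
  simp [reflLoz]
  ring

theorem mem_image_reflTri (R : Finset Tri) (t : Tri) : t ∈ R.image reflTri ↔ reflTri t ∈ R := by
  rw [mem_image]
  constructor
  · rintro ⟨s, hs, rfl⟩
    rwa [reflTri_reflTri]
  · exact fun h => ⟨_, h, reflTri_reflTri t⟩

theorem reflTri_upT (a j : ℤ) : reflTri (upT a j) = dnT (a + j) (-j - 1) := by
  simp [reflTri, upT, dnT]

theorem reflTri_dnT (a j : ℤ) : reflTri (dnT a j) = upT (a + j + 1) (-j - 1) := by
  simp [reflTri, upT, dnT]

theorem IsTiling.refl {R : Finset Tri} {T : Finset Loz} (h : IsTiling R T) :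
    IsTiling (R.image reflTri) (T.image reflLoz) := by
  rw [isTiling_iff] at h ⊢
  obtain ⟨hm, hu, hd, iu, id⟩ := h
  simp only [mem_image_reflTri, reflTri_upT, reflTri_dnT, forall_mem_image]
  refine ⟨?_, ?_, ?_, ?_, ?_⟩
  · rintro ⟨⟨a, b⟩, c, d⟩ hl
    obtain ⟨h1, h2, h3⟩ := hm _ hl
    simp only [reflLoz, lozAdj, Prod.mk.injEq] at h1 h2 h3 ⊢
    refine ⟨by omega, ?_, ?_⟩
    · convert h3 using 1
      congr 1 <;> ring
    · convert h2 using 1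
      congr 1 <;> ring
  · intro a j h
    obtain ⟨l, hl, e⟩ := hd _ _ h
    refine ⟨_, mem_image_of_mem _ hl, ?_⟩
    simp only [reflLoz, e, Prod.mk.injEq]
    omega
  · intro a j h
    obtain ⟨l, hl, e⟩ := hu _ _ h
    refine ⟨_, mem_image_of_mem _ hl, ?_⟩
    simp only [reflLoz, e, Prod.mk.injEq]
    omega
  · intro l hl l' hl' e
    rw [id l hl l' hl']
    simp only [reflLoz, Prod.mk.injEq] at e
    exact Prod.ext (by omega) (by omega)
  · intro l hl l' hl' e
    rw [iu l hl l' hl']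
    simp only [reflLoz, Prod.mk.injEq] at e
    exact Prod.ext (by omega) (by omega)

theorem Mtil_image_reflTri (R : Finset Tri) : Mtil (R.image reflTri) ∅ = Mtil R ∅ := by
  have hR : (R.image reflTri).image reflTri = R := by
    ext t
    rw [mem_image_reflTri, mem_image_reflTri, reflTri_reflTri]
  have hT : ∀ T : Finset Loz, (T.image reflLoz).image reflLoz = T := fun T => by
    rw [image_image, show reflLoz ∘ reflLoz = _root_.id from funext reflLoz_reflLoz, image_id]
  refine card_nbij' (fun T => T.image reflLoz) (fun T => T.image reflLoz) ?_ ?_ ?_ ?_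
  · intro T h
    simp only [mem_coe, mem_tilings, notMem_empty, not_false_eq_true, implies_true, and_true] at h ⊢
    exact hR ▸ h.refl
  · intro T h
    simp only [mem_coe, mem_tilings, notMem_empty, not_false_eq_true, implies_true, and_true] at h ⊢
    exact h.refl
  · exact fun T _ => hT T
  · exact fun T _ => hT T

/-- The number of elements of `P` smaller than `a`. -/
def cntLt (P : Finset ℤ) (a : ℤ) : ℕ := #{p ∈ P | p < a}

theorem cntLt_succ (P : Finset ℤ) (a : ℤ) :
    cntLt P (a + 1) = cntLt P a + if a ∈ P then 1 else 0 := by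
  unfold cntLt
  split_ifs with h
  · have : ({p ∈ P | p < a + 1} : Finset ℤ) = insert a {p ∈ P | p < a} := by
      ext p
      simp only [mem_filter, mem_insert]
      grind
    rw [this, card_insert_of_notMem (by simp)]
  · congr 1
    ext p
    simp only [mem_filter]
    grind

theorem cntLt_eq_zero {P : Finset ℤ} {a : ℤ} (h : ∀ p ∈ P, a ≤ p) : cntLt P a = 0 := by
  rw [cntLt, card_eq_zero, filter_eq_empty_iff]
  exact fun p hp => by simpa using h p hp

/-- The part of a region in the strip just above height `j`: up-pointing triangles at the positions
of `P` and down-pointing triangles at the positions of `Q`. -/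
def rowReg (j : ℤ) (P Q : Finset ℤ) : Finset Tri :=
  (P.image fun a => upT a j) ∪ Q.image fun a => dnT a j

theorem upT_mem_rowReg (j : ℤ) (P Q : Finset ℤ) (a k : ℤ) :
    upT a k ∈ rowReg j P Q ↔ k = j ∧ a ∈ P := by
  simp [rowReg, upT, dnT]
  grind

theorem dnT_mem_rowReg (j : ℤ) (P Q : Finset ℤ) (a k : ℤ) :
    dnT a k ∈ rowReg j P Q ↔ k = j ∧ a ∈ Q := by
  simp [rowReg, upT, dnT]
  grind

theorem IsTiling.cntLt_eq {j : ℤ} {P Q : Finset ℤ} {T : Finset Loz}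
    (h : IsTiling (rowReg j P Q) T) (a : ℤ) :
    cntLt Q a = cntLt P a + if ((a, j), (a - 1, j)) ∈ T then 1 else 0 := by
  rw [isTiling_iff] at h
  obtain ⟨hm, hu, hd, iu, id⟩ := h
  simp only [upT_mem_rowReg, dnT_mem_rowReg] at hm hu hd
  obtain ⟨m, hm'⟩ := (P ∪ Q).bddBelow
  have low : ∀ b ≤ m, cntLt P b = 0 ∧ cntLt Q b = 0 := fun b hb =>
    ⟨cntLt_eq_zero fun p hp => hb.trans (hm' (by simp [hp])),
      cntLt_eq_zero fun p hp => hb.trans (hm' (by simp [hp]))⟩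
  rcases le_total a m with ha | ha
  · rw [(low a ha).1, (low a ha).2, if_neg]
    intro hT
    have := hm' (a := a - 1) (by simp [(hm _ hT).2.2.2])
    omega
  · induction a, ha using Int.leInduction with
    | base =>
      rw [(low m le_rfl).1, (low m le_rfl).2, if_neg]
      intro hT
      have := hm' (a := m - 1) (by simp [(hm _ hT).2.2.2])
      omega
    | succ b hb ih =>
      rw [cntLt_succ, cntLt_succ, ih]
      have h1 : b ∈ Q ↔ ((b, j), (b, j)) ∈ T ∨ ((b + 1, j), (b, j)) ∈ T := by
        constructor
        · intro hb
          obtain ⟨⟨⟨c, d⟩, l⟩, hl, rfl⟩ := hd b j ⟨rfl, hb⟩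
          grind [lozAdj]
        · rintro (h | h)
          · exact (hm _ h).2.2.2
          · exact (hm _ h).2.2.2
      have h2 : b ∈ P ↔ ((b, j), (b, j)) ∈ T ∨ ((b, j), (b - 1, j)) ∈ T := by
        constructor
        · intro hb
          obtain ⟨⟨l, ⟨c, d⟩⟩, hl, rfl⟩ := hu b j ⟨rfl, hb⟩
          grind [lozAdj]
        · rintro (h | h)
          · exact (hm _ h).2.1.2
          · exact (hm _ h).2.1.2
      have h3 : ((b, j), (b, j)) ∈ T → ((b + 1, j), (b, j)) ∉ T := fun h h' => by
        simpa using id _ h _ h'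
      have h4 : ((b, j), (b, j)) ∈ T → ((b, j), (b - 1, j)) ∉ T := fun h h' => by
        have e := (Prod.mk.inj (Prod.mk.inj (iu _ h _ h' rfl)).2).1
        omega
      simp only [add_sub_cancel_right]
      grind

theorem Mtil_rowReg (j : ℤ) (P Q : Finset ℤ)
    [Decidable (∀ a, cntLt P a ≤ cntLt Q a ∧ cntLt Q a ≤ cntLt P (a + 1))] :
    Mtil (rowReg j P Q) ∅ =
      if ∀ a, cntLt P a ≤ cntLt Q a ∧ cntLt Q a ≤ cntLt P (a + 1) then 1 else 0 := by
  have key : ∀ T, IsTiling (rowReg j P Q) T → ∀ a b c d, ((a, b), (c, d)) ∈ T ↔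
      a ∈ P ∧ b = j ∧ d = j ∧ c = if cntLt Q a = cntLt P a then a else a - 1 := by
    intro T hT a b c d
    have h1 := hT.cntLt_eq a
    rw [isTiling_iff] at hT
    obtain ⟨hm, hu, hd, iu, id⟩ := hT
    simp only [upT_mem_rowReg, dnT_mem_rowReg] at hm hu hd
    constructor
    · intro h
      have h2 := hm _ h
      have h3 := iu _ h
      grind [lozAdj]
    · rintro ⟨h, rfl, rfl, rfl⟩
      obtain ⟨⟨l, ⟨c, d⟩⟩, hl, rfl⟩ := hu a _ ⟨rfl, h⟩
      have h2 := hm _ hl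
      have h3 := iu _ hl
      grind [lozAdj]
  unfold Mtil
  split_ifs with hc
  · rw [card_eq_one]
    set T₀ : Finset Loz := P.image fun a =>
      ((a, j), (if cntLt Q a = cntLt P a then a else a - 1, j)) with hT₀
    refine ⟨T₀, ?_⟩
    have mT₀ : ∀ a b c d, ((a, b), (c, d)) ∈ T₀ ↔
        a ∈ P ∧ b = j ∧ d = j ∧ c = if cntLt Q a = cntLt P a then a else a - 1 := by
      intro a b c d
      simp only [hT₀, mem_image, Prod.mk.injEq]
      grind
    have h₀ : IsTiling (rowReg j P Q) T₀ := by
      have sP := cntLt_succ P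
      have sQ := cntLt_succ Q
      rw [isTiling_iff]
      simp only [upT_mem_rowReg, dnT_mem_rowReg]
      refine ⟨?_, ?_, ?_, ?_, ?_⟩
      · rintro ⟨⟨a, b⟩, c, d⟩ h
        obtain ⟨ha, rfl, rfl, hc'⟩ := (mT₀ _ _ _ _).1 h
        have := hc a
        have := hc (a + 1)
        have := hc (a - 1)
        have := sQ (a - 1)
        have := sP (a - 1)
        have := sQ a
        have := sP a
        grind [lozAdj]
      · rintro a k ⟨rfl, ha⟩
        exact ⟨_, (mT₀ _ _ _ _).2 ⟨ha, rfl, rfl, rfl⟩, rfl⟩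
      · rintro a k ⟨rfl, ha⟩
        have := hc a
        have := hc (a + 1)
        have := sQ (a + 1)
        have := sP (a + 1)
        have := sQ a
        have := sP a
        by_cases h : a ∈ P ∧ cntLt Q a = cntLt P a
        · exact ⟨((a, k), (a, k)), (mT₀ _ _ _ _).2 (by grind), rfl⟩
        · exact ⟨((a + 1, k), (a, k)), (mT₀ _ _ _ _).2 (by grind), rfl⟩
      · rintro ⟨⟨a, b⟩, c, d⟩ h ⟨⟨a', b'⟩, c', d'⟩ h'
        rw [mT₀] at h h'
        grind
      · rintro ⟨⟨a, b⟩, c, d⟩ h ⟨⟨a', b'⟩, c', d'⟩ h'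
        rw [mT₀] at h h'
        have := hc a
        have := hc a'
        have := sQ a
        have := sP a
        have := sQ a'
        have := sP a'
        grind
    ext T
    rw [mem_tilings, mem_singleton]
    constructor
    · rintro ⟨hT, -⟩
      ext ⟨⟨a, b⟩, c, d⟩
      rw [key T hT, mT₀]
    · rintro rfl
      exact ⟨h₀, by simp⟩
  · rw [card_eq_zero]
    refine eq_empty_of_forall_notMem fun T hT => hc fun a => ?_
    rw [mem_tilings] at hT
    have h1 := hT.1.cntLt_eq a
    have h2 := cntLt_succ P a
    have h3 := key T hT.1 a j (a - 1) j
    grind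

theorem lt_cntLt_image_iff {k : ℕ} {x : Fin k → ℤ} (hx : StrictMono x) (i : Fin k) (a : ℤ) :
    (i : ℕ) < cntLt (univ.image x) a ↔ x i < a := by
  have h : cntLt (univ.image x) a = #{i | x i < a} := by
    rw [cntLt, filter_image, card_image_of_injective _ hx.injective]
  rw [h]
  constructor
  · intro hi
    by_contra! ha
    have : ({i | x i < a} : Finset (Fin k)) ⊆ Iio i := by
      intro l hl
      rw [mem_filter] at hl
      exact mem_Iio.2 (hx.lt_iff_lt.1 (hl.2.trans_le ha))
    have := card_le_card this
    rw [Fin.card_Iio] at this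
    omega
  · intro ha
    have : Iic i ⊆ ({i | x i < a} : Finset (Fin k)) := by
      intro l hl
      rw [mem_filter]
      exact ⟨mem_univ _, (hx.monotone (mem_Iic.1 hl)).trans_lt ha⟩
    have := card_le_card this
    rw [Fin.card_Iic] at this
    omega

theorem cntLt_le_card (P : Finset ℤ) (a : ℤ) : cntLt P a ≤ #P := card_filter_le _ _

theorem cntLt_eq_card {P : Finset ℤ} {a : ℤ} (h : ∀ p ∈ P, p < a) : cntLt P a = #P := by
  rw [cntLt, filter_true_of_mem h]

theorem cntLt_Ico (L R a : ℤ) : cntLt (Ico L R) a = (min a R - L).toNat := by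
  rw [cntLt, ← Int.card_Ico]
  congr 1
  ext p
  simp only [mem_filter, mem_Ico]
  omega

theorem cntLt_sdiff {A X : Finset ℤ} (h : X ⊆ A) (a : ℤ) :
    cntLt (A \ X) a + cntLt X a = cntLt A a := by
  unfold cntLt
  rw [← card_union_of_disjoint]
  · congr 1
    ext p
    simp only [mem_union, mem_filter, mem_sdiff]
    grind
  · rw [disjoint_left]
    simp only [mem_filter, mem_sdiff]
    grind

theorem strictMono_of_interlace {k : ℕ} {x : Fin (k + 1) → ℤ} (hx : StrictMono x) {y : Fin k → ℤ}
    (hy : ∀ i, y i ∈ Ico (x i.castSucc) (x i.succ)) : StrictMono y := by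
  intro i i' h
  have h1 := mem_Ico.1 (hy i)
  have h2 := mem_Ico.1 (hy i')
  have h3 : x i.succ ≤ x i'.castSucc := hx.monotone (by rw [Fin.le_def]; simpa using h)
  omega

theorem interlace_iff {k : ℕ} {L R : ℤ} {x : Fin (k + 1) → ℤ} (hx : StrictMono x)
    (hxr : ∀ i, x i ∈ Ico L R) {Y : Finset ℤ} (hY : Y ⊆ Ico L (R - 1)) :
    (∀ a, cntLt (Ico L R \ univ.image x) a ≤ cntLt (Ico L (R - 1) \ Y) a ∧
      cntLt (Ico L (R - 1) \ Y) a ≤ cntLt (Ico L R \ univ.image x) (a + 1)) ↔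
    ∃ y ∈ Fintype.piFinset fun i : Fin k => Ico (x i.castSucc) (x i.succ), univ.image y = Y := by
  have hX : univ.image x ⊆ Ico L R := image_subset_iff.2 fun i _ => hxr i
  have cX := fun a => (cntLt_sdiff hX a).trans (cntLt_Ico _ _ _)
  have cY := fun a => (cntLt_sdiff hY a).trans (cntLt_Ico _ _ _)
  have kX : #(univ.image x) = k + 1 := by simp [card_image_of_injective _ hx.injective]
  have tX : ∀ a, R ≤ a → cntLt (univ.image x) a = k + 1 := fun a ha => by
    exact (cntLt_eq_card fun p hp => (mem_Ico.1 (hX hp)).2.trans_le ha).trans kX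
  have tY : ∀ a, R - 1 ≤ a → cntLt Y a = #Y := fun a ha =>
    cntLt_eq_card fun p hp => (mem_Ico.1 (hY hp)).2.trans_le ha
  have hLR : L < R := by
    have := mem_Ico.1 (hxr 0)
    omega
  have lX := cntLt_le_card (univ.image x)
  have lY := cntLt_le_card Y
  rw [kX] at lX
  trans #Y = k ∧ ∀ a, cntLt Y a ≤ cntLt (univ.image x) a ∧
    cntLt (univ.image x) (a + 1) ≤ cntLt Y a + 1
  · constructor
    · intro h
      have hk : #Y = k := by
        have := h (R + 1)
        have := cX (R + 1)
        have := cX (R + 1 + 1)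
        have := cY (R + 1)
        have := tX (R + 1) (by omega)
        have := tX (R + 1 + 1) (by omega)
        have := tY (R + 1) (by omega)
        omega
      refine ⟨hk, fun a => ?_⟩
      have := h a
      have := cX a
      have := cX (a + 1)
      have := cY a
      have := tX a
      have := tX (a + 1)
      have := tY a
      have := lX (a + 1)
      omega
    · rintro ⟨hk, h⟩ a
      have := h a
      have := cX a
      have := cX (a + 1)
      have := cY a
      have := tX a
      have := tX (a + 1)
      have := tY a
      omega
  · constructor
    · rintro ⟨hk, h⟩
      refine ⟨Y.orderEmbOfFin hk, ?_, by simp⟩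
      have hy : StrictMono (Y.orderEmbOfFin hk) := (Y.orderEmbOfFin hk).strictMono
      have iy : univ.image (Y.orderEmbOfFin hk) = Y := by simp
      rw [Fintype.mem_piFinset]
      intro i
      rw [mem_Ico]
      have y1 := lt_cntLt_image_iff hy i
      rw [iy] at y1
      constructor
      · have h1 := (y1 (Y.orderEmbOfFin hk i + 1)).2 (by omega)
        have h2 := h (Y.orderEmbOfFin hk i + 1)
        have h3 := (lt_cntLt_image_iff hx i.castSucc (Y.orderEmbOfFin hk i + 1)).1
          (by rw [Fin.val_castSucc]; omega)
        omega
      · have h1 := (lt_cntLt_image_iff hx i.succ (x i.succ + 1)).2 (by omega)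
        have h2 := h (x i.succ)
        rw [Fin.val_succ] at h1
        exact (y1 _).1 (by omega)
    · rintro ⟨y, hy, rfl⟩
      rw [Fintype.mem_piFinset] at hy
      have my := strictMono_of_interlace hx hy
      have ky : #(univ.image y) = k := by simp [card_image_of_injective _ my.injective]
      refine ⟨ky, fun a => ⟨?_, ?_⟩⟩
      · by_contra! hlt
        have hi : cntLt (univ.image x) a < k := by
          have := lY a
          omega
        have h1 := (lt_cntLt_image_iff my ⟨_, hi⟩ a).1 hlt
        have h2 := mem_Ico.1 (hy ⟨_, hi⟩)
        have h3 := (lt_cntLt_image_iff hx (Fin.castSucc ⟨_, hi⟩) a).2 (by omega)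
        simp at h3
      · by_contra! hlt
        have hi : cntLt (univ.image y) a < k := by
          have := lX (a + 1)
          omega
        have h1 := (lt_cntLt_image_iff hx (Fin.succ ⟨_, hi⟩) (a + 1)).1 hlt
        have h2 := mem_Ico.1 (hy ⟨_, hi⟩)
        have h3 := (lt_cntLt_image_iff my ⟨_, hi⟩ a).2 (by omega)
        simp at h3

theorem sum_Mtil_rowReg {k : ℕ} {L R : ℤ} {x : Fin (k + 1) → ℤ} (hx : StrictMono x)
    (hxr : ∀ i, x i ∈ Ico L R) (j : ℤ) (g : Finset ℤ → ℕ) :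
    ∑ Y ∈ (Ico L (R - 1)).powerset,
        Mtil (rowReg j (Ico L R \ univ.image x) (Ico L (R - 1) \ Y)) ∅ * g Y =
      ∑ y ∈ Fintype.piFinset fun i : Fin k => Ico (x i.castSucc) (x i.succ), g (univ.image y) := by
  classical
  simp only [Mtil_rowReg, ite_mul, one_mul, zero_mul]
  rw [← sum_filter]
  have : {Y ∈ (Ico L (R - 1)).powerset |
      ∀ a, cntLt (Ico L R \ univ.image x) a ≤ cntLt (Ico L (R - 1) \ Y) a ∧
      cntLt (Ico L (R - 1) \ Y) a ≤ cntLt (Ico L R \ univ.image x) (a + 1)} =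
      (Fintype.piFinset fun i : Fin k => Ico (x i.castSucc) (x i.succ)).image
        fun y => univ.image y := by
    ext Y
    rw [mem_filter, mem_powerset, mem_image]
    constructor
    · exact fun h => (interlace_iff hx hxr h.1).1 h.2
    · intro h
      have hY : Y ⊆ Ico L (R - 1) := by
        obtain ⟨y, hy, rfl⟩ := h
        rw [Fintype.mem_piFinset] at hy
        refine image_subset_iff.2 fun i _ => ?_
        have h1 := mem_Ico.1 (hy i)
        have h2 := mem_Ico.1 (hxr i.castSucc)
        have h3 := mem_Ico.1 (hxr i.succ)
        rw [mem_Ico]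
        omega
      exact ⟨hY, (interlace_iff hx hxr hY).2 h⟩
  rw [this, sum_image]
  intro y hy y' hy' e
  rw [mem_coe, Fintype.mem_piFinset] at hy hy'
  refine ((strictMono_of_interlace hx hy).range_inj (strictMono_of_interlace hx hy')).1 ?_
  simpa using congrArg (fun s : Finset ℤ => (s : Set ℤ)) e

theorem Mtil_rowReg_of_no_dents {L R : ℤ} (h : L < R) (j : ℤ) (Y : Finset ℤ) :
    Mtil (rowReg j (Ico L R) (Ico L (R - 1) \ Y)) ∅ = 0 := by
  classical
  rw [Mtil_rowReg, if_neg]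
  intro hc
  have h1 := (hc R).1
  have h2 : cntLt (Ico L (R - 1) \ Y) R ≤ cntLt (Ico L (R - 1)) R :=
    card_le_card (filter_subset_filter _ sdiff_subset)
  rw [cntLt_Ico] at h1 h2
  omega

/-- The rows `i, …, m - 1` of a quartered hexagon with base of width `W` and height `m`, with the
up-pointing triangles at the positions of `X` removed from the lowest row. -/
noncomputable def trap (m : ℕ) (W : ℤ) (i : ℕ) (X : Finset ℤ) : Finset Tri :=
  ((Ico i m).biUnion fun j => rowReg j (Ico (-((j / 2 : ℕ) : ℤ)) (W - j))
    (Ico (-(((j + 1) / 2 : ℕ) : ℤ)) (W - j - 1))) \ X.image fun a => upT a i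

theorem upT_mem_trap (m : ℕ) (W : ℤ) (i : ℕ) (X : Finset ℤ) (a j : ℤ) :
    upT a j ∈ trap m W i X ↔
      (i ≤ j ∧ j < m ∧ -(j / 2) ≤ a ∧ a < W - j) ∧ ¬ (j = i ∧ a ∈ X) := by
  simp only [trap, mem_sdiff, mem_biUnion, upT_mem_rowReg, mem_Ico, mem_image]
  simp only [upT, Prod.mk.injEq, true_and]
  refine and_congr ?_ (not_congr ?_)
  · constructor
    · rintro ⟨k, hk⟩
      omega
    · intro h
      exact ⟨j.toNat, by omega⟩
  · grind

theorem dnT_mem_trap (m : ℕ) (W : ℤ) (i : ℕ) (X : Finset ℤ) (a j : ℤ) :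
    dnT a j ∈ trap m W i X ↔
      i ≤ j ∧ j < m ∧ -((j + 1) / 2) ≤ a ∧ a < W - j - 1 := by
  simp only [trap, mem_sdiff, mem_biUnion, dnT_mem_rowReg, mem_Ico, mem_image]
  simp only [upT, dnT, Prod.mk.injEq, Bool.true_eq_false, false_and, and_false, exists_false,
    not_false_eq_true, and_true]
  constructor
  · rintro ⟨k, hk⟩
    omega
  · intro h
    exact ⟨j.toNat, by omega⟩

theorem tri_ext {R R' : Finset Tri} (hu : ∀ a j, upT a j ∈ R ↔ upT a j ∈ R')
    (hd : ∀ a j, dnT a j ∈ R ↔ dnT a j ∈ R') : R = R' := by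
  ext ⟨b, a, j⟩
  cases b
  · exact hd a j
  · exact hu a j

theorem trap_eq_union (m : ℕ) (W : ℤ) (i : ℕ) (hi : i < m) (X : Finset ℤ) :
    trap m W i X = rowReg i (Ico (-((i / 2 : ℕ) : ℤ)) (W - i) \ X)
      (Ico (-(((i + 1) / 2 : ℕ) : ℤ)) (W - i - 1)) ∪ trap m W (i + 1) ∅ := by
  refine tri_ext (fun a j => ?_) fun a j => ?_
  · simp only [mem_union, upT_mem_trap, upT_mem_rowReg, mem_sdiff, mem_Ico, notMem_empty]
    by_cases h : j = i
    · subst h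
      by_cases h' : a ∈ X
      · simp [h']
      · simp [h']
        omega
    · simp [h]
      omega
  · simp only [mem_union, dnT_mem_trap, dnT_mem_rowReg, mem_Ico]
    push_cast
    omega

/-- The number of tilings of `trap m W i X`, except that for `i = m` (no rows left) dents are not
allowed. -/
noncomputable def trapCount (m : ℕ) (W : ℤ) (i : ℕ) (X : Finset ℤ) : ℕ :=
  if i = m then if X = ∅ then 1 else 0 else Mtil (trap m W i X) ∅

theorem trapCount_eq_sum (m : ℕ) (W : ℤ) (i : ℕ) (hi : i < m) (X : Finset ℤ) :
    trapCount m W i X = ∑ Y ∈ (Ico (-(((i + 1) / 2 : ℕ) : ℤ)) (W - i - 1)).powerset,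
      Mtil (rowReg i (Ico (-((i / 2 : ℕ) : ℤ)) (W - i) \ X)
        (Ico (-(((i + 1) / 2 : ℕ) : ℤ)) (W - i - 1) \ Y)) ∅ * trapCount m W (i + 1) Y := by
  rw [trapCount, if_neg hi.ne, trap_eq_union m W i hi]
  by_cases him : i + 1 = m
  · have h0 : trap m W (i + 1) ∅ = ∅ := by
      simp [trap, him]
    rw [h0, union_empty, sum_eq_single ∅]
    · simp [trapCount, him]
    · intro Y _ hY
      simp [trapCount, him, hY]
    · simp
  · rw [Mtil_cut _ _ ∅ (i + 1) ?_ ?_ id Function.injective_id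
      (Ico (-(((i + 1) / 2 : ℕ) : ℤ)) (W - i - 1)) ?_ ?_]
    · refine sum_congr rfl fun Y hY => ?_
      rw [trapCount, if_neg him]
      congr 2
      · refine tri_ext (fun a j => ?_) fun a j => ?_
        · simp only [mem_sdiff, upT_mem_rowReg, mem_image]
          simp [upT, dnT]
        · simp only [mem_sdiff, dnT_mem_rowReg, mem_image]
          simp only [dnT, Prod.mk.injEq]
          grind
      · refine tri_ext (fun a j => ?_) fun a j => ?_
        · simp only [mem_sdiff, upT_mem_trap, mem_image]
          simp only [upT, Prod.mk.injEq]
          push_cast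
          grind
        · simp only [mem_sdiff, dnT_mem_trap, mem_image]
          simp [upT, dnT]
    · rintro ⟨b, a, j⟩ h
      cases b
      · have := (dnT_mem_rowReg _ _ _ _ _).1 h
        simp only
        omega
      · have := (upT_mem_rowReg _ _ _ _ _).1 h
        simp only
        omega
    · rintro ⟨b, a, j⟩ h
      cases b
      · have := (dnT_mem_trap _ _ _ _ _ _).1 h
        simp only
        omega
      · have := (upT_mem_trap _ _ _ _ _ _).1 h
        simp only
        omega
    · intro a ha
      rw [mem_Ico] at ha
      rw [upT_mem_trap, dnT_mem_rowReg, mem_Ico]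
      simp
      omega
    · intro a ha ha' _
      rw [dnT_mem_rowReg] at ha'
      exact ⟨a, ha'.2, rfl⟩

theorem Lreg_eq_trap (m n : ℕ) (A : Finset ℕ) :
    Lreg m n A = trap m ((n + (m + 1) / 2 : ℕ) : ℤ) 0 (A.image fun i : ℕ => (i : ℤ) - 1) := by
  refine tri_ext (fun a j => ?_) fun a j => ?_
  · rw [upT_mem_trap]
    simp only [Lreg, upDents, mem_sdiff, mem_biUnion, mem_range, mem_union, mem_image, upT, dnT,
      Prod.mk.injEq, Bool.false_eq_true, false_and, and_false, exists_false, or_false, true_and]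
    refine and_congr ?_ (not_congr ?_)
    · constructor
      · rintro ⟨k, hk, b, hb⟩
        omega
      · intro h
        exact ⟨j.toNat, by omega, (a + j / 2).toNat, by omega⟩
    · grind
  · rw [dnT_mem_trap]
    simp only [Lreg, upDents, mem_sdiff, mem_biUnion, mem_range, mem_union, mem_image, upT, dnT,
      Prod.mk.injEq, Bool.true_eq_false, false_and, and_false, exists_false, false_or, true_and,
      not_false_eq_true, and_true]
    constructor
    · rintro ⟨k, hk, b, hb⟩
      omega
    · intro h
      exact ⟨j.toNat, by omega, (a + (j + 1) / 2).toNat, by omega⟩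

theorem det_eq_det_succ_sub_castSucc {k : ℕ} (A : Matrix (Fin (k + 1)) (Fin (k + 1)) ℚ)
    (h : ∀ i, A i 0 = 1) :
    A.det = (Matrix.of fun i j : Fin k => A i.succ j.succ - A i.castSucc j.succ).det := by
  rw [Matrix.det_eq_of_forall_row_eq_smul_add_pred (A := A)
    (B := Matrix.of fun i j => Fin.cases (A 0 j) (fun l => A l.succ j - A l.castSucc j) i)
    (fun _ => 1) (by simp) (by simp), Matrix.det_succ_column_zero, Fin.sum_univ_succ, sum_eq_zero]
  · simp only [Fin.val_zero, pow_zero, Matrix.of_apply, Fin.cases_zero, h, one_mul, add_zero]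
    congr 1
  · intro i _
    simp [h]

theorem sum_Ico_int_sub (f : ℤ → ℚ) {p q : ℤ} (h : p ≤ q) :
    ∑ a ∈ Ico p q, (f (a + 1) - f a) = f q - f p := by
  induction q, h using Int.leInduction with
  | base => simp
  | succ q hq ih =>
    rw [← insert_Ico_right_eq_Ico_add_one hq, sum_insert (by simp), ih]
    ring

theorem sum_det_interlace {k : ℕ} {x : Fin (k + 1) → ℤ} (hx : StrictMono x)
    (f F : ℕ → ℤ → ℚ) (hF : ∀ j a, F j (a + 1) - F j a = f j a) :
    ∑ y ∈ Fintype.piFinset fun i : Fin k => Ico (x i.castSucc) (x i.succ),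
        (Matrix.of fun i j : Fin k => f j (y i)).det =
      (Matrix.of fun i j : Fin (k + 1) =>
        (Fin.cases 1 (fun l : Fin k => F l (x i)) j : ℚ)).det := by
  rw [det_eq_det_succ_sub_castSucc _ (by simp)]
  have h := (Matrix.detRowAlternating (R := ℚ) (n := Fin k)).toMultilinearMap.map_sum_finset
    (fun (_ : Fin k) (a : ℤ) (j : Fin k) => f j a) fun i => Ico (x i.castSucc) (x i.succ)
  refine h.symm.trans ?_
  change Matrix.det _ = _
  congr 1
  ext i j
  simp only [Matrix.of_apply, Fin.cases_succ, Finset.sum_apply]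
  rw [← sum_Ico_int_sub _ (hx.monotone i.castSucc_le_succ)]
  exact sum_congr rfl fun a _ => (hF j a).symm

/-- The polynomials `∏_{l < j} (z² - (l + 1/2)²)`. -/
def evenPoly : ℕ → ℚ → ℚ
  | 0, _ => 1
  | j + 1, z => evenPoly j z * (z ^ 2 - (j + 1 / 2) ^ 2)

/-- The polynomials `z ∏_{l < j} (z² - (l + 1)²)`. -/
def oddPoly : ℕ → ℚ → ℚ
  | 0, z => z
  | j + 1, z => oddPoly j z * (z ^ 2 - (j + 1) ^ 2)

theorem evenPoly_add (j : ℕ) (w : ℚ) : evenPoly (j + 1) (w + 1 / 2) = oddPoly j w * (w + j + 1) := by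
  induction j with
  | zero =>
    simp only [evenPoly, oddPoly]
    push_cast
    ring
  | succ j ih =>
    rw [evenPoly, ih, oddPoly]
    push_cast
    ring

theorem evenPoly_sub (j : ℕ) (w : ℚ) : evenPoly (j + 1) (w - 1 / 2) = oddPoly j w * (w - j - 1) := by
  induction j with
  | zero =>
    simp only [evenPoly, oddPoly]
    push_cast
    ring
  | succ j ih =>
    rw [evenPoly, ih, oddPoly]
    push_cast
    ring

theorem oddPoly_add (j : ℕ) (w : ℚ) : oddPoly j (w + 1 / 2) = evenPoly j w * (w + j + 1 / 2) := by
  induction j with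
  | zero =>
    simp only [evenPoly, oddPoly]
    push_cast
    ring
  | succ j ih =>
    rw [oddPoly, ih, evenPoly]
    push_cast
    ring

theorem oddPoly_sub (j : ℕ) (w : ℚ) : oddPoly j (w - 1 / 2) = evenPoly j w * (w - j - 1 / 2) := by
  induction j with
  | zero =>
    simp only [evenPoly, oddPoly]
    push_cast
    ring
  | succ j ih =>
    rw [oddPoly, ih, evenPoly]
    push_cast
    ring

theorem oddPoly_zero (j : ℕ) : oddPoly j 0 = 0 := by
  induction j with
  | zero => rfl
  | succ j ih => rw [oddPoly, ih, zero_mul]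

theorem trapCount_eq_sum_interlace {m : ℕ} {W : ℤ} {i : ℕ} (hi : i < m) (X : Finset ℤ) {k : ℕ}
    {x : Fin (k + 1) → ℤ} (hx : StrictMono x)
    (hxr : ∀ l, x l ∈ Ico (-(((i + 1) / 2 : ℕ) : ℤ)) (W - i))
    (hX : Ico (-((i / 2 : ℕ) : ℤ)) (W - i) \ X =
      Ico (-(((i + 1) / 2 : ℕ) : ℤ)) (W - i) \ univ.image x) :
    trapCount m W i X = ∑ y ∈ Fintype.piFinset fun l : Fin k => Ico (x l.castSucc) (x l.succ),
      trapCount m W (i + 1) (univ.image y) := by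
  rw [trapCount_eq_sum m W i hi, hX]
  exact sum_Mtil_rowReg hx hxr _ fun Y => trapCount m W (i + 1) Y

theorem trapCount_odd {m : ℕ} {W : ℤ} {e : ℕ} (he : 2 * e + 1 < m) (hW : e < W) {c : ℕ → ℚ}
    (hc : ∀ s (y : Fin s → ℤ), StrictMono y → (∀ l, y l ∈ Ico (-(e + 1) : ℤ) (W - (2 * e + 2))) →
      (trapCount m W (2 * e + 2) (univ.image y) : ℚ) =
        c s * (Matrix.of fun i j : Fin s => evenPoly j (y i + e + 1 + 1 / 2)).det)
    {k : ℕ} {x : Fin k → ℤ} (hx : StrictMono x)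
    (hxr : ∀ l, x l ∈ Ico (-e : ℤ) (W - (2 * e + 1))) :
    (trapCount m W (2 * e + 1) (univ.image x) : ℚ) = c k * (∏ j ∈ range k, (1 / (2 * j + 1) : ℚ)) *
      (Matrix.of fun i j : Fin k => oddPoly j (x i + e + 1)).det := by
  set x' : Fin (k + 1) → ℤ := Fin.cons (-(e + 1)) x with hx'
  have mx' : StrictMono x' := by
    intro l l' h
    cases l' using Fin.cases with
    | zero => exact absurd h (Fin.not_lt_zero l)
    | succ l' =>
      cases l using Fin.cases with
      | zero =>
        have := mem_Ico.1 (hxr l')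
        rw [hx', Fin.cons_succ, Fin.cons_zero]
        omega
      | succ l => exact hx (Fin.succ_lt_succ_iff.1 h)
  have hxr' : ∀ l, x' l ∈ Ico (-(e + 1) : ℤ) (W - (2 * e + 1)) := by
    intro l
    rw [mem_Ico]
    cases l using Fin.cases with
    | zero =>
      rw [hx', Fin.cons_zero]
      omega
    | succ l =>
      have := mem_Ico.1 (hxr l)
      rw [hx', Fin.cons_succ]
      omega
  rw [trapCount_eq_sum_interlace he (univ.image x) mx']
  · push_cast
    rw [sum_congr rfl fun y hy => hc k y ?_ ?_, ← mul_sum,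
      sum_det_interlace mx' (fun j a => evenPoly j (a + e + 1 + 1 / 2))
        fun j a => 1 / (2 * j + 1) * oddPoly j (a + e + 1)]
    · rw [Matrix.det_succ_row_zero, Fin.sum_univ_succ, sum_eq_zero]
      · have := Matrix.det_mul_row (fun j : Fin k => (1 / (2 * j + 1) : ℚ))
          (Matrix.of fun i j : Fin k => oddPoly j (x i + e + 1))
        rw [prod_range, mul_assoc (c k), ← this]
        simp [hx', Matrix.submatrix]
      · intro l _
        simp [hx', oddPoly_zero]
    · intro j a
      have h1 := oddPoly_add j (a + e + 1 + 1 / 2)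
      have h2 := oddPoly_sub j (a + e + 1 + 1 / 2)
      have h3 : (2 * j + 1 : ℚ) ≠ 0 := by positivity
      push_cast
      rw [show (a + 1 + e + 1 : ℚ) = a + e + 1 + 1 / 2 + 1 / 2 by ring, h1,
        show (a + e + 1 : ℚ) = a + e + 1 + 1 / 2 - 1 / 2 by ring, h2]
      field_simp
      ring_nf
    · rw [Fintype.mem_piFinset] at hy
      exact strictMono_of_interlace mx' hy
    · intro l
      rw [Fintype.mem_piFinset] at hy
      have h1 := mem_Ico.1 (hy l)
      have h2 := mem_Ico.1 (hxr' l.castSucc)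
      have h3 := mem_Ico.1 (hxr' l.succ)
      rw [mem_Ico]
      omega
  · intro l
    convert hxr' l using 2 <;> omega
  · ext a
    simp only [mem_sdiff, mem_Ico, mem_image, mem_univ, true_and, hx', Fin.exists_fin_succ,
      Fin.cons_zero, Fin.cons_succ]
    have : ∀ l, x l ≠ -(e + 1) := fun l h => by
      have := mem_Ico.1 (hxr l)
      omega
    by_cases h : ∃ l, x l = a
    · simp [h]
    · simp [h]
      omega

theorem trapCount_even {m : ℕ} {W : ℤ} {e : ℕ} (he : 2 * e < m) {c : ℕ → ℚ}
    (hc : ∀ s (y : Fin s → ℤ), StrictMono y → (∀ l, y l ∈ Ico (-e : ℤ) (W - (2 * e + 1))) →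
      (trapCount m W (2 * e + 1) (univ.image y) : ℚ) =
        c s * (Matrix.of fun i j : Fin s => oddPoly j (y i + e + 1)).det)
    {k : ℕ} {x : Fin (k + 1) → ℤ} (hx : StrictMono x)
    (hxr : ∀ l, x l ∈ Ico (-e : ℤ) (W - 2 * e)) :
    (trapCount m W (2 * e) (univ.image x) : ℚ) = c k * (∏ j ∈ range k, (1 / (2 * j + 2) : ℚ)) *
      (Matrix.of fun i j : Fin (k + 1) => evenPoly j (x i + e + 1 / 2)).det := by
  rw [trapCount_eq_sum_interlace he (univ.image x) hx]
  · push_cast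
    rw [sum_congr rfl fun y hy => hc k y ?_ ?_, ← mul_sum,
      sum_det_interlace hx (fun j a => oddPoly j (a + e + 1))
        fun j a => 1 / (2 * j + 2) * evenPoly (j + 1) (a + e + 1 / 2)]
    · have := Matrix.det_mul_row
        (fun j : Fin (k + 1) => (Fin.cases 1 (fun l : Fin k => (1 / (2 * l + 2) : ℚ)) j : ℚ))
        (Matrix.of fun i j : Fin (k + 1) => evenPoly j (x i + e + 1 / 2))
      rw [Fin.prod_univ_succ] at this
      simp only [Fin.cases_zero, one_mul, Fin.cases_succ] at this
      rw [prod_range, mul_assoc (c k), ← this]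
      congr 2
      ext i j
      cases j using Fin.cases with
      | zero => simp [evenPoly]
      | succ j => simp
    · intro j a
      have h1 := evenPoly_add j (a + e + 1)
      have h2 := evenPoly_sub j (a + e + 1)
      have h3 : (2 * j + 2 : ℚ) ≠ 0 := by positivity
      push_cast
      rw [show (a + 1 + e + 1 / 2 : ℚ) = a + e + 1 + 1 / 2 by ring, h1,
        show (a + e + 1 / 2 : ℚ) = a + e + 1 - 1 / 2 by ring, h2]
      field_simp
      ring_nf
    · rw [Fintype.mem_piFinset] at hy
      exact strictMono_of_interlace hx hy
    · intro l
      rw [Fintype.mem_piFinset] at hy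
      have h1 := mem_Ico.1 (hy l)
      have h2 := mem_Ico.1 (hxr l.castSucc)
      have h3 := mem_Ico.1 (hxr l.succ)
      rw [mem_Ico]
      omega
  · intro l
    convert hxr l using 2 <;> omega
  · rw [show (2 * e + 1) / 2 = 2 * e / 2 by omega]

theorem trapCount_even_empty {m : ℕ} {W : ℤ} {e : ℕ} (he : 2 * e < m) (hW : e < W) :
    trapCount m W (2 * e) ∅ = 0 := by
  rw [trapCount_eq_sum m W _ he, sum_eq_zero]
  intro Y _
  rw [show (2 * e + 1) / 2 = 2 * e / 2 by omega, sdiff_empty,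
    Mtil_rowReg_of_no_dents (by omega), zero_mul]

theorem exists_trapCount_even (M : ℕ) (W : ℤ) (hW : M ≤ W) (r : ℕ) : ∀ e : ℕ, e + r = M →
    ∃ c : ℕ → ℚ, (∀ s, s ≠ r → c s = 0) ∧
      ∀ s (x : Fin s → ℤ), StrictMono x → (∀ l, x l ∈ Ico (-e : ℤ) (W - 2 * e)) →
        (trapCount (2 * M) W (2 * e) (univ.image x) : ℚ) =
          c s * (Matrix.of fun i j : Fin s => evenPoly j (x i + e + 1 / 2)).det := by
  induction r with
  | zero =>
    rintro e rfl
    refine ⟨fun s => if s = 0 then 1 else 0, fun s hs => by simp [hs], fun s x _ _ => ?_⟩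
    rcases s with _ | s
    · simp [trapCount]
    · simp [trapCount, univ_eq_empty_iff]
  | succ r ih =>
    intro e he
    obtain ⟨c, hc0, hc⟩ := ih (e + 1) (by omega)
    have ho := fun k x hx hxr => trapCount_odd (m := 2 * M) (W := W) (e := e) (by omega) (by omega)
      (c := c) (fun s y hy hyr => by
        have := hc s y hy fun l => by
          convert hyr l using 2 <;> omega
        rw [show 2 * e + 2 = 2 * (e + 1) by ring, this]
        push_cast
        simp only [add_assoc]) (k := k) (x := x) hx hxr
    refine ⟨fun s => match s with
      | 0 => 0
      | k + 1 => c k * (∏ j ∈ range k, (1 / (2 * j + 1) : ℚ)) *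
        ∏ j ∈ range k, (1 / (2 * j + 2) : ℚ), ?_, ?_⟩
    · rintro (_ | k) hk
      · rfl
      · simp [hc0 k (by omega)]
    · rintro (_ | k) x hx hxr
      · simp [trapCount_even_empty (m := 2 * M) (W := W) (e := e) (by omega) (by omega)]
      · exact trapCount_even (by omega) ho hx hxr

theorem evenPoly_eq_eval (j : ℕ) (z : ℚ) : evenPoly j z = Polynomial.eval (z ^ 2)
    (∏ l ∈ range j, (Polynomial.X - Polynomial.C (((l : ℚ) + 1 / 2) ^ 2))) := by
  induction j with
  | zero => simp [evenPoly]
  | succ j ih => rw [evenPoly, ih, prod_range_succ, Polynomial.eval_mul]; simp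

theorem det_evenPoly {k : ℕ} (z : Fin k → ℚ) :
    (Matrix.of fun i j : Fin k => evenPoly j (z i)).det =
      ∏ i, ∏ j ∈ Ioi i, (z j ^ 2 - z i ^ 2) := by
  rw [← Matrix.det_vandermonde (fun i => z i ^ 2),
    Matrix.det_eval_matrixOfPolynomials_eq_det_vandermonde _
      (fun j : Fin k => ∏ l ∈ range j, (Polynomial.X - Polynomial.C (((l : ℚ) + 1 / 2) ^ 2)))]
  · simp only [evenPoly_eq_eval]
  · intro i
    rw [Polynomial.natDegree_finsetProd_X_sub_C_eq_card, card_range]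
  · exact fun i => Polynomial.monic_prod_X_sub_C _ _

theorem prodDS1_image {k : ℕ} {x : Fin k → ℕ} (hx : StrictMono x) : prodDS1 (univ.image x) =
    ∏ i, ∏ j ∈ Ioi i, (((x j : ℚ) - 1 / 2) ^ 2 - ((x i : ℚ) - 1 / 2) ^ 2) := by
  rw [prodDS1, prod_image hx.injective.injOn]
  refine prod_congr rfl fun i _ => ?_
  rw [filter_image, prod_image hx.injective.injOn]
  refine prod_congr ?_ fun j _ => by ring
  ext j
  simp [hx.lt_iff_lt]

theorem exists_Mtil_Lreg (k W : ℕ) (hW : k ≤ W) :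
    ∃ c : ℚ, ∀ A ⊆ Icc 1 W, (k = 0 → A = ∅) →
      (Mtil (Lreg (2 * k) (W - k) A) ∅ : ℚ) = if #A = k then c * prodDS1 A else 0 := by
  obtain ⟨c, hc0, hc⟩ := exists_trapCount_even k W (by exact_mod_cast hW) k 0 (zero_add k)
  refine ⟨c k, fun A hA hk => ?_⟩
  have h1 : Mtil (Lreg (2 * k) (W - k) A) ∅ =
      trapCount (2 * k) W (2 * 0) (A.image fun i : ℕ => (i : ℤ) - 1) := by
    rw [Lreg_eq_trap, show W - k + (2 * k + 1) / 2 = W by omega, trapCount]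
    rcases k.eq_zero_or_pos with rfl | hk0
    · rw [if_pos rfl, if_pos (by simp [hk rfl])]
      simp [trap, Mtil_empty]
    · rw [if_neg (by omega)]
  obtain ⟨s, x, mx, rfl⟩ : ∃ (s : ℕ) (x : Fin s → ℕ), StrictMono x ∧ univ.image x = A :=
    ⟨_, A.orderEmbOfFin rfl, (A.orderEmbOfFin rfl).strictMono, by simp⟩
  have h2 := hc s (fun i => (x i : ℤ) - 1) (fun i j h => by have := mx h; simp only; omega)
    fun l => by
      have := mem_Icc.1 (hA (mem_image_of_mem x (mem_univ l)))
      rw [mem_Ico]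
      push_cast
      omega
  rw [h1, image_image, card_image_of_injective _ mx.injective, card_univ, Fintype.card_fin]
  refine h2.trans ?_
  split_ifs with h
  · rw [det_evenPoly, ← h, prodDS1_image mx]
    congr 1
    refine prod_congr rfl fun i _ => prod_congr rfl fun j _ => ?_
    push_cast
    ring
  · rw [hc0 _ h, zero_mul]

theorem Lreg_union (m n : ℕ) (A S : Finset ℕ) : Lreg m n (A ∪ S) = Lreg m n A \ upDents S := by
  rw [Lreg, Lreg, sdiff_sdiff_left, upDents, image_union]
  rfl

theorem image_reflTri_upDents (S : Finset ℕ) : (upDents S).image reflTri = dnDents S := by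
  rw [upDents, dnDents, image_image]
  refine image_congr fun i _ => ?_
  simp [reflTri_upT]

theorem image_reflTri_Lreg_union (m n : ℕ) (A S : Finset ℕ) :
    (Lreg m n (A ∪ S)).image reflTri = (Lreg m n A).image reflTri \ dnDents S := by
  rw [Lreg_union, image_sdiff _ _ (Function.LeftInverse.injective reflTri_reflTri),
    image_reflTri_upDents]

theorem upT_mem_Lreg (m n : ℕ) (A : Finset ℕ) (a j : ℤ) :
    upT a j ∈ Lreg m n A ↔ (0 ≤ j ∧ j < m ∧ -(j / 2) ≤ a ∧ a < n + (m + 1) / 2 - j) ∧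
      ¬ (j = 0 ∧ (a + 1).toNat ∈ A ∧ 0 ≤ a + 1) := by
  rw [Lreg_eq_trap, upT_mem_trap]
  push_cast
  refine and_congr Iff.rfl (not_congr (and_congr Iff.rfl ?_))
  rw [mem_image]
  constructor
  · rintro ⟨i, hi, rfl⟩
    simpa using hi
  · rintro ⟨h, h'⟩
    exact ⟨_, h, by omega⟩

theorem dnT_mem_Lreg (m n : ℕ) (A : Finset ℕ) (a j : ℤ) :
    dnT a j ∈ Lreg m n A ↔ 0 ≤ j ∧ j < m ∧ -((j + 1) / 2) ≤ a ∧ a < n + (m + 1) / 2 - j - 1 := by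
  rw [Lreg_eq_trap, dnT_mem_trap]
  push_cast
  rfl

theorem Mtil_upper_barrierLoz (m n : ℕ) (A B : Finset ℕ) :
    Mtil (Lreg m n A) (barrierLoz B) = Mtil (Lreg m n A) ∅ := by
  refine Mtil_eq_of_not_mem _ _ fun l hl _ h => ?_
  obtain ⟨i, -, rfl⟩ := mem_image.1 hl
  have := (dnT_mem_Lreg _ _ _ _ _).1 h
  simp only at this
  omega

theorem Mtil_lower_barrierLoz (m n : ℕ) (A B : Finset ℕ) :
    Mtil ((Lreg m n A).image reflTri) (barrierLoz B) = Mtil (Lreg m n A) ∅ := by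
  rw [← Mtil_image_reflTri]
  refine Mtil_eq_of_not_mem _ _ fun l hl h => ?_
  obtain ⟨i, -, rfl⟩ := mem_image.1 hl
  rw [mem_image_reflTri, reflTri_upT] at h
  have := (dnT_mem_Lreg _ _ _ _ _).1 h
  simp only at this
  omega

theorem Mtil_Lreg_glue (m m' n n' : ℕ) (W : ℕ) (hW : n + (m + 1) / 2 = W)
    (hW' : n' + (m' + 1) / 2 = W) (U D B C : Finset ℕ)
    (hC : C = if 0 < m ∧ 0 < m' then Icc 1 W \ (U ∪ D ∪ B) else ∅) :
    Mtil (Lreg m n U ∪ (Lreg m' n' D).image reflTri) (barrierLoz B) =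
      ∑ S ∈ C.powerset, Mtil (Lreg m' n' (D ∪ S)) ∅ * Mtil (Lreg m n (U ∪ S)) ∅ := by
  have hB : ∀ a : ℤ, vertLoz a 0 ∈ barrierLoz B ↔ ∃ i ∈ B, (i : ℤ) - 1 = a := by
    intro a
    simp only [vertLoz, barrierLoz, mem_image, Prod.mk.injEq]
    grind
  rw [union_comm, Mtil_cut ((Lreg m' n' D).image reflTri) (Lreg m n U) (barrierLoz B) 0 ?_ ?_
    (fun i : ℕ => (i : ℤ) - 1) (fun i i' h => by simpa using h) C ?_ ?_]
  · refine sum_congr rfl fun S _ => ?_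
    change Mtil (_ \ dnDents S) _ * Mtil (_ \ upDents S) _ = _
    rw [← Lreg_union, ← image_reflTri_Lreg_union, Mtil_upper_barrierLoz, Mtil_lower_barrierLoz]
  · rintro ⟨b, a, j⟩ h
    rw [mem_image_reflTri] at h
    cases b
    · have := (upT_mem_Lreg _ _ _ _ _).1 ((reflTri_dnT a j) ▸ h)
      simp only
      omega
    · have := (dnT_mem_Lreg _ _ _ _ _).1 ((reflTri_upT a j) ▸ h)
      simp only
      omega
  · rintro ⟨b, a, j⟩ h
    cases b
    · exact ((dnT_mem_Lreg _ _ _ _ _).1 h).1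
    · exact ((upT_mem_Lreg _ _ _ _ _).1 h).1.1
  · intro i hi
    rw [hC] at hi
    split_ifs at hi with h
    · simp only [mem_sdiff, mem_Icc, mem_union, not_or] at hi
      rw [upT_mem_Lreg, mem_image_reflTri, reflTri_dnT, upT_mem_Lreg, hB]
      simp only [zero_sub, sub_add_cancel, Int.toNat_natCast]
      refine ⟨⟨by omega, by simp [hi]⟩, ⟨by omega, ?_⟩, ?_⟩
      · simp [hi]
      · rintro ⟨i', hi', e⟩
        have : i' = i := by omega
        simp_all
    · simp at hi
  · intro a h1 h2 h3
    rw [upT_mem_Lreg] at h1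
    rw [mem_image_reflTri, reflTri_dnT, upT_mem_Lreg] at h2
    rw [hB] at h3
    refine ⟨(a + 1).toNat, ?_, by omega⟩
    rw [hC, if_pos (by omega)]
    simp only [mem_sdiff, mem_Icc, mem_union, not_or]
    refine ⟨by omega, ⟨fun h => h1.2 ⟨rfl, h, by omega⟩, fun h => h2.2 ⟨by omega, ?_, by omega⟩⟩,
      fun h => h3 ⟨_, h, by omega⟩⟩
    convert h using 2
    omega

/-- The absolute value of `(p - 1/2)² - (q - 1/2)²`, for positive `p` and `q`. -/
def gap (p q : ℕ) : ℚ :=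
  if p < q then ((q : ℚ) - 1 / 2) ^ 2 - ((p : ℚ) - 1 / 2) ^ 2
  else ((p : ℚ) - 1 / 2) ^ 2 - ((q : ℚ) - 1 / 2) ^ 2

theorem gap_self (p : ℕ) : gap p p = 0 := by simp [gap]

theorem prodDS1_insert {a : ℕ} {A : Finset ℕ} (ha : a ∉ A) :
    prodDS1 (insert a A) = prodDS1 A * ∏ q ∈ A, gap a q := by
  have h1 : ∀ p ∈ A, ∏ q ∈ insert a A with p < q, (((q : ℚ) - p) * (q + p - 1)) =
      (if p < a then gap a p else 1) * ∏ q ∈ A with p < q, (((q : ℚ) - p) * (q + p - 1)) := by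
    intro p hp
    rw [filter_insert]
    split_ifs with h
    · rw [prod_insert (by simp [ha]), gap, if_neg (by omega)]
      ring
    · rw [one_mul]
  have h2 : ∏ q ∈ insert a A with a < q, (((q : ℚ) - a) * (q + a - 1)) =
      ∏ q ∈ A, if a < q then gap a q else 1 := by
    rw [filter_insert, if_neg (lt_irrefl a), prod_filter]
    refine prod_congr rfl fun q _ => ?_
    split_ifs with h
    · rw [gap, if_pos h]
      ring
    · rfl
  rw [prodDS1, prod_insert ha, prod_congr rfl h1, h2, prod_mul_distrib, ← mul_assoc,
    ← prod_mul_distrib, mul_comm, prodDS1]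
  congr 1
  refine prod_congr rfl fun q hq => ?_
  have : q ≠ a := fun h => ha (h ▸ hq)
  split_ifs <;> first | omega | simp

theorem prodDS1_union {U S : Finset ℕ} (h : Disjoint S U) :
    prodDS1 (U ∪ S) = prodDS1 U * prodDS1 S * ∏ s ∈ S, ∏ u ∈ U, gap s u := by
  induction S using Finset.induction_on with
  | empty => simp [prodDS1]
  | insert a S ha ih =>
    rw [disjoint_insert_left] at h
    rw [union_insert, prodDS1_insert (by simp [ha, h.1]), ih h.2, prodDS1_insert ha,
      prod_insert ha, prod_union h.2.symm]
    ring

/-- The discrete Selberg-type sum over the `k`-element subsets of `P` with weight `w`. -/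
def vdmSum (k : ℕ) (P : Finset ℕ) (w : ℕ → ℚ) : ℚ :=
  ∑ S ∈ powersetCard k P, prodDS1 S ^ 2 * ∏ s ∈ S, w s

theorem vdmSum_congr {k : ℕ} {P : Finset ℕ} {w w' : ℕ → ℚ} (h : ∀ p ∈ P, w p = w' p) :
    vdmSum k P w = vdmSum k P w' :=
  sum_congr rfl fun _ hS => congrArg _ <|
    prod_congr rfl fun p hp => h p ((mem_powersetCard.1 hS).1 hp)

theorem vdmSum_erase {k : ℕ} {P : Finset ℕ} {w : ℕ → ℚ} {a : ℕ} (h : w a = 0) :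
    vdmSum k (P.erase a) w = vdmSum k P w := by
  refine sum_subset (powersetCard_mono (erase_subset _ _)) fun S hS hS' => ?_
  rw [mem_powersetCard] at hS hS'
  have : a ∈ S := by
    by_contra ha
    exact hS' ⟨subset_erase.2 ⟨hS.1, ha⟩, hS.2⟩
  rw [prod_eq_zero this h, mul_zero]

theorem Mtil_Freg_eq {W : ℕ} {c : ℕ → ℚ}
    (hc : ∀ k ≤ W, ∀ A ⊆ Icc 1 W, (k = 0 → A = ∅) →
      (Mtil (Lreg (2 * k) (W - k) A) ∅ : ℚ) = if #A = k then c k * prodDS1 A else 0)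
    {x y n : ℕ} {U D : Finset ℕ} (B : Finset ℕ) (hW : x + y + n = W) (hU : U ⊆ Icc 1 W)
    (hD : D ⊆ Icc 1 W) (hu : #U ≤ x + n) (hd : #D ≤ x + n) :
    (Mtil (Freg x y n U D) (barrierLoz B) : ℚ) =
      c (y + #U) * c (y + #D) * (prodDS1 U * prodDS1 D) *
        vdmSum y (Icc 1 W \ (U ∪ D ∪ B))
          fun s => (∏ u ∈ U, gap s u) * ∏ d ∈ D, gap s d := by
  rw [Freg, show 2 * y + 2 * #U = 2 * (y + #U) by ring, show 2 * y + 2 * #D = 2 * (y + #D) by ring,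
    show x + n - #U = W - (y + #U) by omega, show x + n - #D = W - (y + #D) by omega,
    Mtil_Lreg_glue _ _ _ _ W (by omega) (by omega) U D B _ rfl]
  push_cast
  set C := if 0 < 2 * (y + #U) ∧ 0 < 2 * (y + #D) then Icc 1 W \ (U ∪ D ∪ B) else ∅ with hC
  have hCs : C ⊆ Icc 1 W \ (U ∪ D ∪ B) := by
    rw [hC]
    split_ifs <;> simp
  have key : ∀ S ∈ C.powerset,
      (Mtil (Lreg (2 * (y + #D)) (W - (y + #D)) (D ∪ S)) ∅ : ℚ) *
        Mtil (Lreg (2 * (y + #U)) (W - (y + #U)) (U ∪ S)) ∅ =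
      if #S = y then c (y + #U) * c (y + #D) * (prodDS1 U * prodDS1 D) *
        (prodDS1 S ^ 2 * ∏ s ∈ S, ((∏ u ∈ U, gap s u) * ∏ d ∈ D, gap s d)) else 0 := by
    intro S hS
    have hS' := mem_powerset.1 hS
    have hSP := hS'.trans hCs
    have hSW : S ⊆ Icc 1 W := hSP.trans sdiff_subset
    have dU : Disjoint S U := disjoint_left.2 fun s hs h => by
      have := hSP hs
      simp_all
    have dD : Disjoint S D := disjoint_left.2 fun s hs h => by
      have := hSP hs
      simp_all
    have e1 : ¬ (0 < y + #U ∧ 0 < y + #D) → S = ∅ := fun h => by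
      rw [hC, if_neg (by omega)] at hS'
      exact subset_empty.1 hS'
    rw [hc _ (by omega) _ (union_subset hD hSW), hc _ (by omega) _ (union_subset hU hSW),
      card_union_of_disjoint dU.symm, card_union_of_disjoint dD.symm]
    · by_cases h : #S = y
      · rw [if_pos (by omega), if_pos (by omega), if_pos h, prodDS1_union dU, prodDS1_union dD,
          prod_mul_distrib]
        ring
      · rw [if_neg (by omega), if_neg h, zero_mul]
    · intro h
      rw [e1 (by omega), union_empty]
      exact card_eq_zero.1 (by omega)
    · intro h
      rw [e1 (by omega), union_empty]
      exact card_eq_zero.1 (by omega)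
  rw [sum_congr rfl key, ← sum_filter, ← mul_sum, ← powersetCard_eq_filter, vdmSum]
  congr 2
  rw [hC]
  split_ifs with h
  · rfl
  · rw [show y = 0 by omega]
    simp

theorem sum_piFinset_injective {k : ℕ} (P : Finset ℕ) (F : (Fin k → ℕ) → ℚ)
    (hF : ∀ s, ¬ Function.Injective s → F s = 0) :
    ∑ s ∈ Fintype.piFinset fun _ : Fin k => P, F s =
      ∑ S ∈ (powersetCard k P).attach, ∑ σ : Equiv.Perm (Fin k),
        F (S.1.orderEmbOfFin (mem_powersetCard.1 S.2).2 ∘ σ) := by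
  classical
  rw [← sum_filter_of_ne (p := Function.Injective) fun s _ h => by
      by_contra h'
      exact h (hF s h'),
    ← sum_fiberwise_of_maps_to (t := powersetCard k P) (g := fun s => univ.image s), ← sum_attach]
  · refine sum_congr rfl fun S _ => ?_
    obtain ⟨S, hS⟩ := S
    have hk := (mem_powersetCard.1 hS).2
    symm
    refine sum_nbij (fun σ => S.orderEmbOfFin hk ∘ σ) ?_ ?_ ?_ fun _ _ => rfl
    · intro σ _
      simp only [mem_filter, Fintype.mem_piFinset]
      refine ⟨⟨fun i => (mem_powersetCard.1 hS).1 (S.orderEmbOfFin_mem hk _),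
        (S.orderEmbOfFin hk).injective.comp σ.injective⟩, ?_⟩
      rw [← image_image, image_univ_equiv]
      simp
    · intro σ _ τ _ h
      ext1 i
      exact (S.orderEmbOfFin hk).injective (congrFun h i)
    · intro s hs
      simp only [coe_filter, mem_filter, Set.mem_ofPred_eq] at hs
      obtain ⟨⟨-, hi⟩, him⟩ := hs
      have hm : ∀ i, s i ∈ S := fun i => him ▸ mem_image_of_mem s (mem_univ i)
      refine ⟨Equiv.ofBijective (fun i => (S.orderIsoOfFin hk).symm ⟨s i, hm i⟩)
        (Finite.injective_iff_bijective.1 fun i j h => hi ?_), mem_coe.2 (mem_univ _), ?_⟩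
      · simpa using h
      · ext i
        simp [← coe_orderIsoOfFin_apply]
  · intro s hs
    rw [mem_filter, Fintype.mem_piFinset] at hs
    rw [mem_powersetCard, card_image_of_injective _ hs.2]
    exact ⟨image_subset_iff.2 fun i _ => hs.1 i, by simp⟩

theorem vdmSum_eq_det (k : ℕ) (P : Finset ℕ) (w : ℕ → ℚ) : vdmSum k P w =
    (Matrix.of fun i j : Fin k =>
      ∑ p ∈ P, w p * (((p : ℚ) - 1 / 2) ^ 2) ^ ((i : ℕ) + j)).det := by
  set t : ℕ → ℚ := fun p => ((p : ℚ) - 1 / 2) ^ 2 with ht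
  have h1 : (Matrix.of fun i j : Fin k => ∑ p ∈ P, w p * t p ^ ((i : ℕ) + j)).det =
      ∑ s ∈ Fintype.piFinset fun _ : Fin k => P, (∏ i, w (s i) * t (s i) ^ (i : ℕ)) *
        (Matrix.vandermonde fun i => t (s i)).det := by
    have h := (Matrix.detRowAlternating (R := ℚ) (n := Fin k)).toMultilinearMap.map_sum_finset
      (fun (i : Fin k) (p : ℕ) (j : Fin k) => w p * t p ^ ((i : ℕ) + j)) fun _ => P
    refine Eq.trans ?_ (h.trans (sum_congr rfl fun s _ => ?_))
    · change _ = Matrix.det _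
      congr 1
      ext i j
      simp only [Matrix.of_apply, Finset.sum_apply]
    · rw [← Matrix.det_mul_column]
      change Matrix.det _ = _
      congr 1
      ext i j
      simp only [Matrix.of_apply, Matrix.vandermonde_apply]
      ring
  rw [h1, sum_piFinset_injective, vdmSum, ← sum_attach]
  · refine sum_congr rfl fun S _ => ?_
    obtain ⟨S, hS⟩ := S
    have hk := (mem_powersetCard.1 hS).2
    obtain ⟨x, hx, mx, ix⟩ : ∃ x : Fin k → ℕ, ⇑(S.orderEmbOfFin hk) = x ∧ StrictMono x ∧
        univ.image x = S :=
      ⟨_, rfl, (S.orderEmbOfFin hk).strictMono, by simp⟩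
    simp only [hx]
    have hv : prodDS1 S = (Matrix.vandermonde fun i => t (x i)).det := by
      rw [← ix, prodDS1_image mx, Matrix.det_vandermonde]
    have hw : ∀ σ : Equiv.Perm (Fin k), (∏ i, w ((x ∘ σ) i) * t ((x ∘ σ) i) ^ (i : ℕ)) *
        (Matrix.vandermonde fun i => t ((x ∘ σ) i)).det =
        (∏ s ∈ S, w s) * prodDS1 S * (Equiv.Perm.sign σ * ∏ i, t (x (σ i)) ^ (i : ℕ)) := by
      intro σ
      have e1 : (Matrix.vandermonde fun i => t ((x ∘ σ) i)) =
          (Matrix.vandermonde fun i => t (x i)).submatrix σ id := rfl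
      rw [e1, Matrix.det_permute, prod_mul_distrib, hv, ← ix, prod_image mx.injective.injOn,
        ← Equiv.prod_comp σ fun i => w (x i)]
      simp only [Function.comp]
      ring
    rw [sum_congr rfl fun σ _ => hw σ, ← mul_sum]
    have hd := (Matrix.det_apply' (Matrix.vandermonde fun i => t (x i)))
    simp only [Matrix.vandermonde_apply] at hd
    rw [← hd, ← hv]
    ring
  · intro s hs
    rw [Matrix.det_vandermonde_eq_zero_iff.2, mul_zero]
    rw [Function.Injective] at hs
    push Not at hs
    obtain ⟨i, j, h, hne⟩ := hs
    exact ⟨i, j, by rw [h], hne⟩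

theorem det_updateRow_plucker {n : Type*} [Fintype n] [DecidableEq n] (X : Matrix n n ℚ) {p q : n}
    (hpq : p ≠ q) (a e m b : n → ℚ) :
    ((X.updateRow p a).updateRow q e).det * ((X.updateRow p m).updateRow q b).det =
      ((X.updateRow p m).updateRow q e).det * ((X.updateRow p a).updateRow q b).det +
        ((X.updateRow p a).updateRow q m).det * ((X.updateRow p e).updateRow q b).det := by
  set Y := (X.updateRow p a).updateRow q e with hY
  have hg : ∀ u, ((X.updateRow p u).updateRow q b).det =
      Matrix.cramer (X.updateRow q b).transpose u p := fun u => by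
    rw [Matrix.cramer_transpose_apply, Matrix.updateRow_comm _ hpq]
  have h1 : Y.det • m = ∑ i, (Matrix.cramer Y.transpose m i) • Y i := by
    have := Matrix.mulVec_cramer Y.transpose m
    rw [Matrix.det_transpose] at this
    rw [← this]
    ext j
    simp [Matrix.mulVec, dotProduct, mul_comm]
  have h2 : Y.det * ((X.updateRow p m).updateRow q b).det =
      ∑ i, Matrix.cramer Y.transpose m i * ((X.updateRow p (Y i)).updateRow q b).det := by
    rw [hg, ← smul_eq_mul, ← Pi.smul_apply, ← map_smul, h1, map_sum, Finset.sum_apply]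
    simp only [map_smul, Pi.smul_apply, smul_eq_mul, hg]
  rw [h2, ← sum_subset (subset_univ {p, q}), sum_pair hpq]
  · congr 2
    · rw [Matrix.cramer_transpose_apply, hY, Matrix.updateRow_comm _ hpq.symm,
        Matrix.updateRow_idem]
    · rw [hY, Matrix.updateRow_ne hpq, Matrix.updateRow_self]
    · rw [Matrix.cramer_transpose_apply, hY, Matrix.updateRow_idem]
    · rw [hY, Matrix.updateRow_self]
  · intro i _ hi
    simp only [mem_insert, mem_singleton, not_or] at hi
    rw [mul_eq_zero]
    right
    refine Matrix.det_zero_of_row_eq (i := i) (j := p) hi.1 ?_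
    rw [Matrix.updateRow_ne hi.2, Matrix.updateRow_ne hi.1, Matrix.updateRow_ne hpq,
      Matrix.updateRow_self, hY, Matrix.updateRow_ne hi.2, Matrix.updateRow_ne hi.1]

/-- The square matrix with the given rows and one more row at the bottom. -/
def snocRow {k : ℕ} (ρ : Fin k → Fin (k + 1) → ℚ) (v : Fin (k + 1) → ℚ) :
    Matrix (Fin (k + 1)) (Fin (k + 1)) ℚ :=
  Matrix.of (Fin.snoc (α := fun _ => Fin (k + 1) → ℚ) ρ v)

theorem det_snocRow_single {k : ℕ} (ρ : Fin k → Fin (k + 1) → ℚ) :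
    (snocRow ρ (Pi.single (Fin.last k) 1)).det = (Matrix.of fun i j => ρ i j.castSucc).det := by
  rw [Matrix.det_succ_row _ (Fin.last k), Fin.sum_univ_castSucc, sum_eq_zero, zero_add]
  · simp only [snocRow, Matrix.of_apply, Fin.snoc_last, Pi.single_eq_same, mul_one]
    rw [Even.neg_one_pow ⟨_, rfl⟩, one_mul]
    congr 1
    ext i j
    simp
  · intro i _
    simp [snocRow, (Fin.castSucc_lt_last i).ne]

theorem det_snocRow_pow {k : ℕ} (ρ : Fin k → Fin (k + 1) → ℚ) (b : ℚ) :
    (snocRow ρ fun j => b ^ (j : ℕ)).det =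
      (Matrix.of fun i j => b * ρ i j.castSucc - ρ i j.succ).det := by
  rw [Matrix.det_eq_of_forall_col_eq_smul_add_pred (A := snocRow ρ fun j => b ^ (j : ℕ))
    (B := Matrix.of fun i j => Fin.cases ((snocRow ρ fun j => b ^ (j : ℕ)) i 0)
      (fun l => (snocRow ρ fun j => b ^ (j : ℕ)) i l.succ -
        b * (snocRow ρ fun j => b ^ (j : ℕ)) i l.castSucc) j) (fun _ => b) (by simp) (by simp),
    Matrix.det_succ_row _ (Fin.last k), Fin.sum_univ_succ, sum_eq_zero, add_zero]
  · have := Matrix.det_neg (Matrix.of fun i j : Fin k => ρ i j.succ - b * ρ i j.castSucc)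
    rw [Fintype.card_fin] at this
    simp only [snocRow, Matrix.of_apply, Fin.snoc_last, Fin.cases_zero, Fin.val_zero, pow_zero,
      mul_one, Fin.val_last, add_zero]
    trans (-1) ^ k * (Matrix.of fun i j : Fin k => ρ i j.succ - b * ρ i j.castSucc).det
    · congr 2
      ext i j
      simp
    · rw [← this]
      congr 1
      ext i j
      simp
  · intro i _
    simp [snocRow, pow_succ, mul_comm]

/-- The Hankel determinant of order `k` of a sequence. -/
def hankelDet (k : ℕ) (μ : ℕ → ℚ) : ℚ := (Matrix.of fun i j : Fin k => μ (i + j)).det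

theorem hankelDet_neg (k : ℕ) (μ ν : ℕ → ℚ) (h : ∀ j, μ j = -ν j) :
    hankelDet k μ = (-1) ^ k * hankelDet k ν := by
  have := Matrix.det_neg (Matrix.of fun i j : Fin k => ν (i + j))
  rw [Fintype.card_fin] at this
  rw [hankelDet, hankelDet, ← this]
  congr 1
  ext i j
  simp [h]

theorem hankelDet_condensation (r : ℕ) (μ : ℕ → ℚ) (a b : ℚ) :
    (b - a) * hankelDet (r + 1) μ *
        hankelDet r (fun j => (b * μ (j + 1) - μ (j + 2)) - a * (b * μ j - μ (j + 1))) =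
      hankelDet (r + 1) (fun j => b * μ j - μ (j + 1)) *
          hankelDet r (fun j => μ (j + 1) - a * μ j) +
        hankelDet (r + 1) (fun j => μ (j + 1) - a * μ j) *
          hankelDet r (fun j => b * μ j - μ (j + 1)) := by
  set V : Fin r → Fin (r + 2) → ℚ := fun i j => μ (i + j) with hV
  set m : Fin (r + 2) → ℚ := fun j => μ (r + j) with hm
  set e : Fin (r + 2) → ℚ := Pi.single (Fin.last (r + 1)) 1 with he
  set pa : Fin (r + 2) → ℚ := fun j => a ^ (j : ℕ) with hpa
  set pb : Fin (r + 2) → ℚ := fun j => b ^ (j : ℕ) with hpb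
  have hu : ∀ u v, ((snocRow (Fin.snoc (α := fun _ => Fin (r + 2) → ℚ) V 0) 0).updateRow
      (Fin.last r).castSucc u).updateRow (Fin.last (r + 1)) v =
      snocRow (Fin.snoc (α := fun _ => Fin (r + 2) → ℚ) V u) v := by
    intro u v
    ext i j
    cases i using Fin.lastCases with
    | last => simp [snocRow]
    | cast i =>
      rw [Matrix.updateRow_ne (Fin.castSucc_lt_last i).ne]
      cases i using Fin.lastCases with
      | last => simp [snocRow]
      | cast i =>
        rw [Matrix.updateRow_ne (by simp [Fin.ext_iff]; omega)]
        simp [snocRow]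
  have hP := det_updateRow_plucker
    (snocRow (Fin.snoc (α := fun _ => Fin (r + 2) → ℚ) V 0) 0)
    (Fin.castSucc_lt_last (Fin.last r)).ne pa e m pb
  simp only [hu] at hP
  have hVm : Fin.snoc (α := fun _ => Fin (r + 2) → ℚ) V m =
      fun (i : Fin (r + 1)) (j : Fin (r + 2)) => μ (i + j) := by
    ext i j
    cases i using Fin.lastCases <;> simp [hV, hm]
  have h_me : (snocRow (Fin.snoc (α := fun _ => Fin (r + 2) → ℚ) V m) e).det =
      hankelDet (r + 1) μ := by
    rw [hVm, he, det_snocRow_single, hankelDet]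
    rfl
  have h_mb : (snocRow (Fin.snoc (α := fun _ => Fin (r + 2) → ℚ) V m) pb).det =
      hankelDet (r + 1) (fun j => b * μ j - μ (j + 1)) := by
    rw [hVm, hpb, det_snocRow_pow, hankelDet]
    rfl
  have h_pow_e : ∀ c : ℚ, (snocRow (Fin.snoc (α := fun _ => Fin (r + 2) → ℚ) V
      fun j => c ^ (j : ℕ)) e).det = hankelDet r (fun j => c * μ j - μ (j + 1)) := by
    intro c
    rw [he, det_snocRow_single]
    trans (snocRow (fun (i : Fin r) (j : Fin (r + 1)) => μ (i + j)) fun j => c ^ (j : ℕ)).det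
    · congr 1
      ext i j
      cases i using Fin.lastCases <;> simp [hV, snocRow]
    · rw [det_snocRow_pow, hankelDet]
      rfl
  have swap : ∀ u v, (snocRow (Fin.snoc (α := fun _ => Fin (r + 2) → ℚ) V u) v).det =
      -(snocRow (Fin.snoc (α := fun _ => Fin (r + 2) → ℚ) V v) u).det := by
    intro u v
    have := Matrix.det_permute (Equiv.swap (Fin.last r).castSucc (Fin.last (r + 1)))
      (snocRow (Fin.snoc (α := fun _ => Fin (r + 2) → ℚ) V v) u)
    rw [Equiv.Perm.sign_swap (Fin.castSucc_lt_last (Fin.last r)).ne] at this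
    push_cast at this
    rw [← neg_one_mul, ← this]
    congr 1
    ext i j
    cases i using Fin.lastCases with
    | last => simp [snocRow]
    | cast i =>
      cases i using Fin.lastCases with
      | last => simp [snocRow]
      | cast i =>
        rw [Matrix.submatrix_apply, Equiv.swap_apply_of_ne_of_ne (by simp [Fin.ext_iff]; omega)
          (Fin.castSucc_lt_last _).ne]
        simp [snocRow]
  have h_ab : (snocRow (Fin.snoc (α := fun _ => Fin (r + 2) → ℚ) V pa) pb).det =
      (b - a) * hankelDet r
        (fun j => a * (b * μ j - μ (j + 1)) - (b * μ (j + 1) - μ (j + 2))) := by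
    rw [hpb, det_snocRow_pow]
    trans (b - a) * (snocRow (fun (i : Fin r) (j : Fin (r + 1)) => b * μ (i + j) - μ (i + j + 1))
      fun j => a ^ (j : ℕ)).det
    · have hv : ∏ i, Fin.snoc (α := fun _ => ℚ) (fun _ : Fin r => 1) (b - a) i = b - a := by
        simp [Fin.prod_univ_castSucc]
      rw [← hv, ← Matrix.det_mul_column]
      congr 1
      ext i j
      cases i using Fin.lastCases with
      | last =>
        simp only [hpa, snocRow, Matrix.of_apply, Fin.snoc_last, Fin.val_castSucc, Fin.val_succ]
        ring
      | cast i =>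
        simp [hV, snocRow, add_assoc]
    · rw [det_snocRow_pow, hankelDet]
      rfl
  have h_ma : (snocRow (Fin.snoc (α := fun _ => Fin (r + 2) → ℚ) V m) pa).det =
      hankelDet (r + 1) (fun j => a * μ j - μ (j + 1)) := by
    rw [hVm, hpa, det_snocRow_pow, hankelDet]
    rfl
  rw [swap pa m, swap e pb, h_ma, h_me, h_mb, h_ab, h_pow_e, h_pow_e,
    hankelDet_neg r (fun j => a * μ j - μ (j + 1)) (fun j => μ (j + 1) - a * μ j)
      (fun j => by ring),
    hankelDet_neg (r + 1) (fun j => a * μ j - μ (j + 1)) (fun j => μ (j + 1) - a * μ j)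
      (fun j => by ring),
    hankelDet_neg r (fun j => a * (b * μ j - μ (j + 1)) - (b * μ (j + 1) - μ (j + 2)))
      (fun j => (b * μ (j + 1) - μ (j + 2)) - a * (b * μ j - μ (j + 1))) (fun j => by ring),
    pow_succ] at hP
  rcases neg_one_pow_eq_or ℚ r with h | h <;> rw [h] at hP
  · linear_combination -hP
  · linear_combination hP

theorem vdmSum_eq_hankelDet {k : ℕ} {P : Finset ℕ} {w : ℕ → ℚ} {μ : ℕ → ℚ}
    (h : ∀ j, μ j = ∑ p ∈ P, w p * (((p : ℚ) - 1 / 2) ^ 2) ^ j) :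
    vdmSum k P w = hankelDet k μ := by
  rw [vdmSum_eq_det, hankelDet]
  simp only [h]

theorem vdmSum_condensation (r : ℕ) (P : Finset ℕ) (w : ℕ → ℚ) (a b : ℚ) :
    (b - a) * vdmSum (r + 1) P w *
        vdmSum r P (fun p => (((p : ℚ) - 1 / 2) ^ 2 - a) * ((b - ((p : ℚ) - 1 / 2) ^ 2) * w p)) =
      vdmSum (r + 1) P (fun p => (b - ((p : ℚ) - 1 / 2) ^ 2) * w p) *
          vdmSum r P (fun p => (((p : ℚ) - 1 / 2) ^ 2 - a) * w p) +
        vdmSum (r + 1) P (fun p => (((p : ℚ) - 1 / 2) ^ 2 - a) * w p) *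
          vdmSum r P (fun p => (b - ((p : ℚ) - 1 / 2) ^ 2) * w p) := by
  set μ : ℕ → ℚ := fun j => ∑ p ∈ P, w p * (((p : ℚ) - 1 / 2) ^ 2) ^ j with hμ
  have hb : ∀ j, b * μ j - μ (j + 1) =
      ∑ p ∈ P, ((b - ((p : ℚ) - 1 / 2) ^ 2) * w p) * (((p : ℚ) - 1 / 2) ^ 2) ^ j := fun j => by
    simp only [hμ, mul_sum, ← sum_sub_distrib]
    exact sum_congr rfl fun p _ => by ring
  have ha : ∀ j, μ (j + 1) - a * μ j =
      ∑ p ∈ P, ((((p : ℚ) - 1 / 2) ^ 2 - a) * w p) * (((p : ℚ) - 1 / 2) ^ 2) ^ j := fun j => by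
    simp only [hμ, mul_sum, ← sum_sub_distrib]
    exact sum_congr rfl fun p _ => by ring
  have hab : ∀ j, (b * μ (j + 1) - μ (j + 2)) - a * (b * μ j - μ (j + 1)) =
      ∑ p ∈ P, ((((p : ℚ) - 1 / 2) ^ 2 - a) * ((b - ((p : ℚ) - 1 / 2) ^ 2) * w p)) *
        (((p : ℚ) - 1 / 2) ^ 2) ^ j := fun j => by
    rw [hb (j + 1), hb j, mul_sum, ← sum_sub_distrib]
    exact sum_congr rfl fun p _ => by ring
  rw [vdmSum_eq_hankelDet (μ := μ) (fun _ => rfl), vdmSum_eq_hankelDet hab,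
    vdmSum_eq_hankelDet hb, vdmSum_eq_hankelDet ha, vdmSum_eq_hankelDet hb,
    vdmSum_eq_hankelDet ha]
  exact hankelDet_condensation r μ a b

theorem gap_of_le {p q : ℕ} (h : p ≤ q) :
    gap p q = ((q : ℚ) - 1 / 2) ^ 2 - ((p : ℚ) - 1 / 2) ^ 2 := by
  rcases h.lt_or_eq with h | rfl
  · rw [gap, if_pos h]
  · rw [gap_self, sub_self]

theorem gap_of_ge {p q : ℕ} (h : q ≤ p) :
    gap p q = ((p : ℚ) - 1 / 2) ^ 2 - ((q : ℚ) - 1 / 2) ^ 2 := by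
  rw [gap, if_neg h.not_gt]

/-- The `vdmSum` form of condensation at the extreme elements of `P`. -/
theorem vdmSum_condensation_erase (r : ℕ) (P : Finset ℕ) (w : ℕ → ℚ) {α β : ℕ}
    (hmin : ∀ s ∈ P, α ≤ s) (hmax : ∀ s ∈ P, s ≤ β) (hαβ : α < β) :
    gap α β * vdmSum (r + 1) P w *
        vdmSum r ((P.erase β).erase α) (fun s => gap s α * (gap s β * w s)) =
      vdmSum (r + 1) (P.erase β) (fun s => gap s β * w s) *
          vdmSum r (P.erase α) (fun s => gap s α * w s) +
        vdmSum (r + 1) (P.erase α) (fun s => gap s α * w s) *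
          vdmSum r (P.erase β) (fun s => gap s β * w s) := by
  rw [vdmSum_erase (by simp [gap_self]), vdmSum_erase (by simp [gap_self]),
    vdmSum_erase (by simp [gap_self]), vdmSum_erase (by simp [gap_self]),
    vdmSum_erase (by simp [gap_self]), vdmSum_erase (by simp [gap_self]), gap_of_le hαβ.le]
  have h1 : ∀ k, vdmSum k P (fun s => gap s β * w s) = vdmSum k P
      (fun p => (((β : ℚ) - 1 / 2) ^ 2 - ((p : ℚ) - 1 / 2) ^ 2) * w p) := fun k =>
    vdmSum_congr fun p hp => by rw [gap_of_le (hmax p hp)]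
  have h2 : ∀ k, vdmSum k P (fun s => gap s α * w s) = vdmSum k P
      (fun p => (((p : ℚ) - 1 / 2) ^ 2 - ((α : ℚ) - 1 / 2) ^ 2) * w p) := fun k =>
    vdmSum_congr fun p hp => by rw [gap_of_ge (hmin p hp)]
  have h3 : vdmSum r P (fun s => gap s α * (gap s β * w s)) = vdmSum r P
      (fun p => (((p : ℚ) - 1 / 2) ^ 2 - ((α : ℚ) - 1 / 2) ^ 2) *
        ((((β : ℚ) - 1 / 2) ^ 2 - ((p : ℚ) - 1 / 2) ^ 2) * w p)) :=
    vdmSum_congr fun p hp => by rw [gap_of_ge (hmin p hp), gap_of_le (hmax p hp)]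
  rw [h1, h1, h2, h2, h3]
  exact vdmSum_condensation r P w _ _

/-- **Recurrence (5.10)** for `F`-type halved hexagons, obtained by Kuo
condensation. -/
theorem kuo_recurrence_F
    (x y n : ℕ) (hy : 0 < y)
    (U D B : Finset ℕ) (α β : ℕ)
    (hUsub : U ⊆ Finset.Icc 1 (x + y + n)) (hDsub : D ⊆ Finset.Icc 1 (x + y + n))
    (hn : (U ∪ D).card = n)
    (hBsub : B ⊆ Finset.Icc 1 (x + y + n) \ (U ∪ D)) (hBc : B.card < x)
    (hα : α ∈ Finset.Icc 1 (x + y + n) \ (U ∪ D ∪ B))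
    (hβ : β ∈ Finset.Icc 1 (x + y + n) \ (U ∪ D ∪ B))
    (hmin : ∀ s ∈ Finset.Icc 1 (x + y + n) \ (U ∪ D ∪ B), α ≤ s)
    (hmax : ∀ s ∈ Finset.Icc 1 (x + y + n) \ (U ∪ D ∪ B), s ≤ β)
    (hαβ : α < β) :
    Mtil (Freg x y n U D) (barrierLoz B) *
        Mtil (Freg (x - 1) (y - 1) (n + 2) (insert α (insert β U)) D) (barrierLoz B) =
      Mtil (Freg (x - 1) y (n + 1) (insert β U) D) (barrierLoz B) *
          Mtil (Freg x (y - 1) (n + 1) (insert α U) D) (barrierLoz B) +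
        Mtil (Freg (x - 1) y (n + 1) (insert α U) D) (barrierLoz B) *
          Mtil (Freg x (y - 1) (n + 1) (insert β U) D) (barrierLoz B) := by
  obtain ⟨c, hc⟩ : ∃ c : ℕ → ℚ, ∀ k ≤ x + y + n, ∀ A ⊆ Icc 1 (x + y + n), (k = 0 → A = ∅) →
      (Mtil (Lreg (2 * k) (x + y + n - k) A) ∅ : ℚ) = if #A = k then c k * prodDS1 A else 0 := by
    choose c hc using fun k : Iic (x + y + n) => exists_Mtil_Lreg k _ (mem_Iic.1 k.2)
    exact ⟨fun k => if hk : k ≤ x + y + n then c ⟨k, mem_Iic.2 hk⟩ else 0, fun k hk => by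
      simpa only [dif_pos hk] using hc ⟨k, mem_Iic.2 hk⟩⟩
  obtain ⟨r, rfl⟩ : ∃ r, y = r + 1 := ⟨y - 1, by omega⟩
  have hx : 0 < x := by omega
  have hu : #U ≤ n := hn ▸ card_le_card subset_union_left
  have hd : #D ≤ n := hn ▸ card_le_card subset_union_right
  obtain ⟨hαW, hα⟩ := mem_sdiff.1 hα
  obtain ⟨hβW, hβ⟩ := mem_sdiff.1 hβ
  have hαU : α ∉ U := fun h => hα (by simp [h])
  have hβU : β ∉ U := fun h => hβ (by simp [h])
  have hαβU : α ∉ insert β U := by simp [hαU, hαβ.ne]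
  set P := Icc 1 (x + (r + 1) + n) \ (U ∪ D ∪ B) with hP
  set w : ℕ → ℚ := fun s => (∏ u ∈ U, gap s u) * ∏ d ∈ D, gap s d with hw
  have hPe : ∀ a V, Icc 1 (x + (r + 1) + n) \ (insert a V ∪ D ∪ B) =
      (Icc 1 (x + (r + 1) + n) \ (V ∪ D ∪ B)).erase a := fun a V => by
    rw [insert_union, insert_union, sdiff_insert]
  have key := vdmSum_condensation_erase r P w hmin hmax hαβ
  have hUα : insert α U ⊆ Icc 1 (x + (r + 1) + n) := insert_subset hαW hUsub
  have hUβ : insert β U ⊆ Icc 1 (x + (r + 1) + n) := insert_subset hβW hUsub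
  have hcα : #(insert α U) = #U + 1 := card_insert_of_notMem hαU
  have hcβ : #(insert β U) = #U + 1 := card_insert_of_notMem hβU
  have hcαβ : #(insert α (insert β U)) = #U + 2 := by rw [card_insert_of_notMem hαβU, hcβ]
  have hDS : prodDS1 U * prodDS1 (insert α (insert β U)) =
      gap α β * (prodDS1 (insert α U) * prodDS1 (insert β U)) := by
    rw [prodDS1_insert hαβU, prod_insert hβU, prodDS1_insert hαU]
    ring
  have e1 := Mtil_Freg_eq hc B (x := x) (y := r + 1) (n := n) rfl hUsub hDsub
    (by omega) (by omega)
  have e2 := Mtil_Freg_eq hc B (x := x - 1) (y := r) (n := n + 2) (by omega)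
    (insert_subset hαW hUβ) hDsub (by omega) (by omega)
  have e3 := Mtil_Freg_eq hc B (x := x - 1) (y := r + 1) (n := n + 1) (by omega) hUβ hDsub
    (by omega) (by omega)
  have e4 := Mtil_Freg_eq hc B (x := x) (y := r) (n := n + 1) (by omega) hUα hDsub
    (by omega) (by omega)
  have e5 := Mtil_Freg_eq hc B (x := x - 1) (y := r + 1) (n := n + 1) (by omega) hUα hDsub
    (by omega) (by omega)
  have e6 := Mtil_Freg_eq hc B (x := x) (y := r) (n := n + 1) (by omega) hUβ hDsub
    (by omega) (by omega)
  simp only [hPe, ← hP, prod_insert hαU, prod_insert hβU, prod_insert hαβU, mul_assoc,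
    hcα, hcβ, hcαβ] at e1 e2 e3 e4 e5 e6
  have i1 : r + (#U + 2) = r + 1 + (#U + 1) := by ring
  have i2 : r + (#U + 1) = r + 1 + #U := by ring
  rw [i1] at e2
  rw [i2] at e4 e6
  have goal : (Mtil (Freg x (r + 1) n U D) (barrierLoz B) : ℚ) *
        Mtil (Freg (x - 1) r (n + 2) (insert α (insert β U)) D) (barrierLoz B) =
      Mtil (Freg (x - 1) (r + 1) (n + 1) (insert β U) D) (barrierLoz B) *
          Mtil (Freg x r (n + 1) (insert α U) D) (barrierLoz B) +
        Mtil (Freg (x - 1) (r + 1) (n + 1) (insert α U) D) (barrierLoz B) *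
          Mtil (Freg x r (n + 1) (insert β U) D) (barrierLoz B) := by
    rw [e1, e2, e3, e4, e5, e6]
    set K := c (r + 1 + #U) * c (r + 1 + #D) * (c (r + 1 + (#U + 1)) * c (r + #D)) *
      prodDS1 D ^ 2
    linear_combination (K * (prodDS1 (insert α U) * prodDS1 (insert β U))) * key +
      K * vdmSum (r + 1) P w * vdmSum r ((P.erase β).erase α)
        (fun s => gap s α * (gap s β * w s)) * hDS
  exact_mod_cast goal
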